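/- arXiv:1407.5801 — 14 statements merged into one kernel-verified Lean document; each statement's English description precedes it below -/
import Mathlib

section
/- Let S be a (q-1)-semiarc in a finite projective plane of order q with q ≥ 2. Then S is a set of three non-collinear points, i.e. S has exactly 3 elements and no line contains all of S. -/
/-- A line `ℓ` is a tangent to the pointset `S` at the point `p` if `S ∩ ℓ = {p}`. -/
def IsTangentLine {P L : Type*} [Membership P L] (S : Set P) (ℓ : L) (p : P) : Prop :=
  S ∩ {x | x ∈ ℓ} = {p}

/-- A `t`-semiarc: a nonempty pointset `S` such that through each of its points
there pass exactly `t` tangent lines. -/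
def IsSemiarc (P L : Type*) [Membership P L] (t : ℕ) (S : Set P) : Prop :=
  S.Nonempty ∧ ∀ p ∈ S, {ℓ : L | IsTangentLine S ℓ p}.ncard = t

/-- The secants (non-tangent lines) through a point of a `(q-1)`-semiarc are exactly two. -/
theorem secants_card (P L : Type*) [Membership P L] [Fintype P] [Fintype L]
    [Configuration.ProjectivePlane P L] (q : ℕ) (hq2 : 2 ≤ q)
    (hq : Configuration.ProjectivePlane.order P L = q)
    (S : Set P) (hS : IsSemiarc P L (q - 1) S) (p : P) (hp : p ∈ S) :
    {ℓ : L | p ∈ ℓ ∧ ∃ x ∈ S, x ≠ p ∧ x ∈ ℓ}.ncard = 2 := by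
  have h1 : {ℓ : L | p ∈ ℓ}.ncard = q + 1 := by
    have := Configuration.ProjectivePlane.lineCount_eq L p
    rw [hq] at this
    exact this
  have h2 := hS.2 p hp
  have h3 : {ℓ : L | p ∈ ℓ ∧ ∃ x ∈ S, x ≠ p ∧ x ∈ ℓ}
      = {ℓ : L | p ∈ ℓ} \ {ℓ : L | IsTangentLine S ℓ p} := by
    ext ℓ
    simp only [Set.mem_setOf_eq, Set.mem_diff, IsTangentLine, Set.ext_iff, Set.mem_inter_iff,
      Set.mem_singleton_iff]
    constructor
    · rintro ⟨h, x, hx, hne, hl⟩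
      exact ⟨h, fun ht => hne ((ht x).1 ⟨hx, hl⟩)⟩
    · rintro ⟨h, ht⟩
      refine ⟨h, ?_⟩
      by_contra hc
      push Not at hc
      refine ht fun x => ⟨fun hx => ?_, fun hx => hx ▸ ⟨hp, h⟩⟩
      by_contra hne
      exact hc x hx.1 hne hx.2
  have h4 : {ℓ : L | IsTangentLine S ℓ p} ⊆ {ℓ : L | p ∈ ℓ} := by
    intro ℓ hl
    have : p ∈ S ∩ {x | x ∈ ℓ} := by
      rw [show S ∩ {x | x ∈ ℓ} = {p} from hl]; rfl
    exact this.2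
  rw [h3, Set.ncard_sdiff h4 (Set.toFinite _), h1, h2]
  omega

/-- A `(q-1)`-semiarc in a finite projective plane of order `q ≥ 2` is a set of three
non-collinear points. -/
theorem semiarc_q_sub_one (P L : Type*) [Membership P L] [Fintype P] [Fintype L]
    [Configuration.ProjectivePlane P L] (q : ℕ) (hq2 : 2 ≤ q)
    (hq : Configuration.ProjectivePlane.order P L = q)
    (S : Set P) (hS : IsSemiarc P L (q - 1) S) :
    S.ncard = 3 ∧ ¬ ∃ ℓ : L, ∀ p ∈ S, p ∈ ℓ := by
  have E : ∀ {a b : P} {l m : L}, a ∈ l → b ∈ l → a ∈ m → b ∈ m → a = b ∨ l = m :=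
    fun h1 h2 h3 h4 => Configuration.Nondegenerate.eq_or_eq h1 h2 h3 h4
  -- if two distinct secants pass through `x`, every point of `S` is on one of them
  have key : ∀ x ∈ S, ∀ l m : L, l ≠ m → x ∈ l → x ∈ m → (∃ y ∈ S, y ≠ x ∧ y ∈ l) →
      (∃ y ∈ S, y ≠ x ∧ y ∈ m) → ∀ y ∈ S, y ∈ l ∨ y ∈ m := by
    intro x hx l m hlm hxl hxm hl hm y hy
    by_cases hyx : y = x
    · left; rwa [hyx]
    obtain ⟨u, v, -, huv⟩ := Set.ncard_eq_two.1 (secants_card P L q hq2 hq S hS x hx)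
    have hl' : l = u ∨ l = v := by
      have : l ∈ ({u, v} : Set L) := huv ▸ ⟨hxl, hl⟩
      simpa using this
    have hm' : m = u ∨ m = v := by
      have : m ∈ ({u, v} : Set L) := huv ▸ ⟨hxm, hm⟩
      simpa using this
    have hk := Configuration.HasLines.mkLine_ax (P := P) (L := L) hyx
    have hk' : Configuration.HasLines.mkLine (L := L) hyx ∈ ({u, v} : Set L) :=
      huv ▸ ⟨hk.2, y, hy, hyx, hk.1⟩
    generalize Configuration.HasLines.mkLine (L := L) hyx = k at hk hk'
    have hk'' : k = u ∨ k = v := by simpa using hk'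
    have : k = l ∨ k = m := by grind
    rcases this with rfl | rfl
    · exact Or.inl hk.1
    · exact Or.inr hk.1
  obtain ⟨p, hp⟩ := hS.1
  obtain ⟨l, m, hlm, hlm'⟩ := Set.ncard_eq_two.1 (secants_card P L q hq2 hq S hS p hp)
  obtain ⟨hpl, a, ha, hap, hal⟩ : l ∈ {ℓ : L | p ∈ ℓ ∧ ∃ x ∈ S, x ≠ p ∧ x ∈ ℓ} := by
    rw [hlm']; simp
  obtain ⟨hpm, b, hb, hbp, hbm⟩ : m ∈ {ℓ : L | p ∈ ℓ ∧ ∃ x ∈ S, x ≠ p ∧ x ∈ ℓ} := by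
    rw [hlm']; simp
  have hbl : b ∉ l := fun h => (E hpl h hpm hbm).elim (fun h => hbp h.symm) hlm
  have ham : a ∉ m := fun h => (E hpl hal hpm h).elim (fun h => hap h.symm) hlm
  have hab : a ≠ b := fun h => hbl (h ▸ hal)
  obtain ⟨k, hak, hbk⟩ : ∃ k : L, a ∈ k ∧ b ∈ k :=
    ⟨_, Configuration.HasLines.mkLine_ax hab⟩
  have hlk : l ≠ k := fun h => hbl (h ▸ hbk)
  have hmk : m ≠ k := fun h => ham (h ▸ hak)
  have K1 := key p hp l m hlm hpl hpm ⟨a, ha, hap, hal⟩ ⟨b, hb, hbp, hbm⟩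
  have K2 := key a ha l k hlk hal hak ⟨p, hp, hap.symm, hpl⟩ ⟨b, hb, hab.symm, hbk⟩
  have K3 := key b hb m k hmk hbm hbk ⟨p, hp, hbp.symm, hpm⟩ ⟨a, ha, hab, hak⟩
  have hSeq : S = {p, a, b} := by
    ext y
    simp only [Set.mem_insert_iff, Set.mem_singleton_iff]
    constructor
    · intro hy
      rcases K1 y hy with h | h
      · rcases K3 y hy with h' | h'
        · exact Or.inl ((E h hpl h' hpm).resolve_right hlm)
        · exact Or.inr (Or.inl ((E h hal h' hak).resolve_right hlk))
      · rcases K2 y hy with h' | h'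
        · exact Or.inl ((E h hpm h' hpl).resolve_right hlm.symm)
        · exact Or.inr (Or.inr ((E h hbm h' hbk).resolve_right hmk))
    · rintro (rfl | rfl | rfl) <;> assumption
  refine ⟨?_, ?_⟩
  · rw [hSeq]
    exact Set.ncard_eq_three.2 ⟨p, a, b, hap.symm, hbp.symm, hab, rfl⟩
  · rintro ⟨n, hn⟩
    have := (E (hn p hp) (hn a ha) hpl hal).resolve_left hap.symm
    exact hbl (this ▸ hn b hb)
end

section
/- Let S be a 2-semiarc in a finite projective plane of order q. Then q ≤ |S| and (|S| : ℝ) ≤ 1 + q·(1 + √(8q − 7))/4. -/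
/-- Size bounds for a 2-semiarc in a finite projective plane of order `q`. -/
theorem two_semiarc_size_bounds (P L : Type*) [Membership P L] [Fintype P] [Fintype L]
    [Configuration.ProjectivePlane P L] (q : ℕ)
    (hq : Configuration.ProjectivePlane.order P L = q)
    (S : Set P) (hS : IsSemiarc P L 2 S) :
    q ≤ S.ncard ∧ (S.ncard : ℝ) ≤ 1 + q * (1 + Real.sqrt (8 * q - 7)) / 4 := by
  classical
  subst hq
  set q := Configuration.ProjectivePlane.order P L with hqdef
  obtain ⟨⟨p₀, hp₀⟩, hT⟩ := hS
  have hSc : S.ncard = S.toFinset.card := Set.ncard_eq_toFinset_card' S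
  set A : Finset P := S.toFinset with hA
  have hmem : ∀ p, p ∈ A ↔ p ∈ S := fun p => by simp [hA]
  rw [hSc]
  -- number of lines through a point
  have hline : ∀ p : P, (∑ l : L, if p ∈ l then (1 : ℝ) else 0) = q + 1 := by
    intro p
    have h := Configuration.ProjectivePlane.lineCount_eq (L := L) p
    rw [Configuration.lineCount, Nat.card_eq_fintype_card, Fintype.card_subtype] at h
    rw [Finset.sum_boole, h]; push_cast; rfl
  -- number of lines through two points
  have hline2 : ∀ p r : P, (∑ l : L, (if p ∈ l then (1 : ℝ) else 0) * (if r ∈ l then 1 else 0))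
      = 1 + if p = r then (q : ℝ) else 0 := by
    intro p r
    by_cases hpr : p = r
    · subst hpr
      simp only [if_true]
      rw [add_comm, ← hline p]
      refine Finset.sum_congr rfl fun l _ => ?_
      split_ifs <;> simp
    · obtain ⟨l, ⟨h1, h2⟩, hu⟩ := Configuration.HasLines.existsUnique_line P L p r hpr
      rw [if_neg hpr, add_zero, Finset.sum_eq_single l]
      · simp [h1, h2]
      · intro m _ hm
        by_cases hp : p ∈ m
        · by_cases hr : r ∈ m
          · exact absurd (hu m ⟨hp, hr⟩) hm
          · simp [hr]
        · simp [hp]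
      · simp
  -- tangent counts
  have hTan : ∀ p ∈ A, (∑ l : L, if IsTangentLine S l p then (1 : ℝ) else 0) = 2 := by
    intro p hp
    have h := hT p ((hmem p).1 hp)
    rw [Set.ncard_eq_toFinset_card', Set.toFinset_ofPred] at h
    rw [Finset.sum_boole, h]; rfl
  let n : L → ℕ := fun l => (A.filter (fun p => p ∈ l)).card
  have hn : ∀ l, (n l : ℝ) = ∑ p ∈ A, if p ∈ l then (1 : ℝ) else 0 := by
    intro l; rw [Finset.sum_boole]
  have htan_iff : ∀ (l : L) (p : P), IsTangentLine S l p ↔ A.filter (fun p => p ∈ l) = {p} := by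
    intro l p
    unfold IsTangentLine
    rw [Set.ext_iff, Finset.ext_iff]
    simp [hmem]
  have hpenc : ∀ p ∈ A, (∑ l : L, (if p ∈ l then (1 : ℝ) else 0) * n l) = A.card + q := by
    intro p hp
    simp_rw [hn, Finset.mul_sum]
    rw [Finset.sum_comm]
    simp_rw [hline2]
    rw [Finset.sum_add_distrib, Finset.sum_ite_eq, if_pos hp]
    simp
  constructor
  · have hp : p₀ ∈ A := (hmem _).2 hp₀
    have h : (∑ l : L, 2 * (if p₀ ∈ l then (1 : ℝ) else 0)) ≤
        ∑ l : L, ((if p₀ ∈ l then (1 : ℝ) else 0) * n l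
          + if IsTangentLine S l p₀ then (1 : ℝ) else 0) := by
      refine Finset.sum_le_sum fun l _ => ?_
      by_cases hl : p₀ ∈ l
      · have hin : p₀ ∈ A.filter (fun p => p ∈ l) := by simp [hp, hl]
        have h1 : 1 ≤ n l := Finset.card_pos.2 ⟨_, hin⟩
        by_cases ht : IsTangentLine S l p₀
        · have : (1 : ℝ) ≤ n l := by exact_mod_cast h1
          simp only [hl, ht, if_true]; linarith
        · have h2 : n l ≠ 1 := by
            intro h1
            obtain ⟨x, hx⟩ := Finset.card_eq_one.1 h1
            rw [hx, Finset.mem_singleton] at hin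
            subst hin
            exact ht ((htan_iff _ _).2 hx)
          have : (2 : ℝ) ≤ n l := by exact_mod_cast (by omega : 2 ≤ n l)
          simp only [hl, ht, if_true, if_false]; linarith
      · simp only [hl, if_false]
        split_ifs <;> norm_num
    rw [← Finset.mul_sum, hline, Finset.sum_add_distrib, hpenc _ hp, hTan _ hp] at h
    have : (q : ℝ) ≤ A.card := by linarith
    exact_mod_cast this
  · -- global counts
    have hsum1 : ∑ l : L, (n l : ℝ) = A.card * (q + 1) := by
      simp_rw [hn]
      rw [Finset.sum_comm]
      simp_rw [hline]
      rw [Finset.sum_const, nsmul_eq_mul]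
    have hsum2 : ∑ l : L, (n l : ℝ) ^ 2 = A.card * (A.card + q) := by
      have : ∀ l, (n l : ℝ) ^ 2 = ∑ p ∈ A, (if p ∈ l then (1 : ℝ) else 0) * n l := by
        intro l
        rw [← Finset.sum_mul, ← hn, sq]
      simp_rw [this]
      rw [Finset.sum_comm, Finset.sum_congr rfl hpenc, Finset.sum_const, nsmul_eq_mul]
    have hone : ∀ l, (if n l = 1 then (1 : ℝ) else 0)
        = ∑ p ∈ A, if IsTangentLine S l p then (1 : ℝ) else 0 := by
      intro l
      split_ifs with h1
      · obtain ⟨x, hx⟩ := Finset.card_eq_one.1 h1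
        have hxA : x ∈ A := by
          have : x ∈ A.filter (fun p => p ∈ l) := by rw [hx]; simp
          exact (Finset.mem_filter.1 this).1
        rw [Finset.sum_eq_single x]
        · rw [if_pos ((htan_iff _ _).2 hx)]
        · intro y _ hy
          rw [if_neg]
          intro ht
          rw [htan_iff, hx] at ht
          exact hy (Finset.singleton_injective ht).symm
        · exact fun h => absurd hxA h
      · symm
        refine Finset.sum_eq_zero fun y _ => if_neg fun ht => h1 ?_
        change (A.filter (fun p => p ∈ l)).card = 1
        rw [(htan_iff _ _).1 ht]; simp
    have hTcount : ∑ l : L, (if n l = 1 then (1 : ℝ) else 0) = 2 * A.card := by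
      simp_rw [hone]
      rw [Finset.sum_comm, Finset.sum_congr rfl hTan]
      simp [mul_comm]
    have hL : ∑ l : L, (1 : ℝ) = (q : ℝ) ^ 2 + q + 1 := by
      have := Configuration.ProjectivePlane.card_lines P L
      rw [Finset.sum_const, Finset.card_univ, this]
      simp [hqdef]
    let N : Finset L := Finset.univ.filter (fun l => ¬ n l = 1)
    have hsplit : ∀ f : L → ℝ, ∑ l ∈ N, f l = ∑ l, f l - ∑ l, if n l = 1 then f l else 0 := by
      intro f
      rw [← Finset.sum_filter_add_sum_filter_not Finset.univ (fun l => n l = 1) f,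
        ← Finset.sum_filter]
      ring
    have e0 : (N.card : ℝ) = (q : ℝ) ^ 2 + q + 1 - 2 * A.card := by
      have := hsplit (fun _ => 1)
      rw [hTcount, hL] at this
      rw [← this]; simp
    have e1 : ∑ l ∈ N, (n l : ℝ) = A.card * (q + 1) - 2 * A.card := by
      rw [hsplit, hsum1, ← hTcount]
      congr 1
      refine Finset.sum_congr rfl fun l _ => ?_
      split_ifs with h <;> simp [h]
    have e2 : ∑ l ∈ N, (n l : ℝ) ^ 2 = A.card * (A.card + q) - 2 * A.card := by
      rw [hsplit, hsum2, ← hTcount]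
      congr 1
      refine Finset.sum_congr rfl fun l _ => ?_
      split_ifs with h <;> simp [h]
    have hCS := sq_sum_le_card_mul_sum_sq (s := N) (f := fun l => (n l : ℝ))
    rw [e0, e1, e2] at hCS
    have hpos : (0 : ℝ) < A.card := by
      exact_mod_cast Finset.card_pos.2 ⟨p₀, (hmem _).2 hp₀⟩
    have ht : (0 : ℝ) ≤ q := Nat.cast_nonneg q
    generalize (A.card : ℝ) = s at hCS hpos ⊢
    generalize (q : ℝ) = t at hCS ht ⊢
    have h1 : s * (t - 1) ^ 2 ≤ (t ^ 2 + t + 1 - 2 * s) * (s + t - 2) := by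
      refine le_of_mul_le_mul_left ?_ hpos
      linarith
    have h2 : (4 * (s - 1) - t) ^ 2 ≤ t ^ 2 * (8 * t - 7) := by linarith
    have h3 := Real.abs_le_sqrt h2
    rw [Real.sqrt_mul (sq_nonneg t), Real.sqrt_sq ht] at h3
    have h4 := (le_abs_self _).trans h3
    linarith
end

section
/- Let S be a 2-semiarc of size q in a finite projective plane of order q. Then S is an arc, i.e. no line contains three distinct points of S. -/
/-- A 2-semiarc of size `q` in a finite projective plane of order `q` is an arc:
no line contains three distinct points of it. -/
theorem two_semiarc_size_q_is_arc (P L : Type*) [Membership P L] [Fintype P] [Fintype L]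
    [Configuration.ProjectivePlane P L] (q : ℕ)
    (hq : Configuration.ProjectivePlane.order P L = q)
    (S : Set P) (hS : IsSemiarc P L 2 S) (hcard : S.ncard = q) :
    ∀ ℓ : L, ∀ a ∈ S, ∀ b ∈ S, ∀ c ∈ S,
      a ∈ ℓ → b ∈ ℓ → c ∈ ℓ → a = b ∨ a = c ∨ b = c := by
  classical
  intro ℓ a ha b hb c hc hal hbl hcl
  by_contra hcon
  push Not at hcon
  obtain ⟨hab, hac, hbc⟩ := hcon
  have hT := hS.2 a ha
  -- the lines through `a`
  have hA : {m : L | a ∈ m}.ncard = q + 1 := by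
    rw [← hq, ← Configuration.ProjectivePlane.lineCount_eq (L := L) a]
    rfl
  have hcover : {m : L | a ∈ m} ⊆ {m : L | IsTangentLine S m a} ∪
      (fun x => if h : a ≠ x then Configuration.HasLines.mkLine (L := L) h else ℓ) ''
        (S \ {a, b}) := by
    intro m hm
    by_cases ht : IsTangentLine S m a
    · exact Or.inl ht
    right
    have key : ∃ x ∈ S, x ∈ m ∧ a ≠ x := by
      by_contra hno
      push Not at hno
      apply ht
      ext y
      constructor
      · rintro ⟨hy, hym⟩
        exact (hno y hy hym).symm
      · rintro rfl
        exact ⟨ha, hm⟩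
    have eqline : ∀ (x : P) (h : a ≠ x), x ∈ m →
        Configuration.HasLines.mkLine (L := L) h = m := by
      intro x h hx
      have h2 := Configuration.HasLines.mkLine_ax (L := L) h
      exact (Configuration.Nondegenerate.eq_or_eq h2.1 h2.2 hm hx).resolve_left h
    obtain ⟨x, hx, hxm, hax⟩ := key
    by_cases hxb : x = b
    · have hml : ℓ = m :=
        (Configuration.Nondegenerate.eq_or_eq hal hbl hm (hxb ▸ hxm)).resolve_left hab
      refine ⟨c, ⟨hc, by simp [hac.symm, hbc.symm]⟩, ?_⟩
      simp only [dif_pos hac]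
      exact eqline c hac (hml ▸ hcl)
    · refine ⟨x, ⟨hx, by simp [hax.symm, hxb]⟩, ?_⟩
      simp only [dif_pos hax]
      exact eqline x hax hxm
  have h1 := Set.ncard_le_ncard hcover (Set.toFinite _)
  have h2 := Set.ncard_union_le {m : L | IsTangentLine S m a}
    ((fun x => if h : a ≠ x then Configuration.HasLines.mkLine (L := L) h else ℓ) ''
        (S \ {a, b}))
  have h3 := Set.ncard_image_le (f := fun x => if h : a ≠ x then
    Configuration.HasLines.mkLine (L := L) h else ℓ) (Set.toFinite (S \ {a, b}))
  have h4 : (S \ {a, b}).ncard + ({a, b} : Set P).ncard = S.ncard :=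
    Set.ncard_sdiff_add_ncard_of_subset (by
      rintro y (rfl | rfl)
      · exact ha
      · exact hb)
  rw [Set.ncard_pair hab] at h4
  omega
end

section
/- Let S be a 2-semiarc of size q + 1 in a finite projective plane of order q. Then q + 1 is divisible by 3. -/
open Configuration in
theorem two_semiarc_key (P L : Type*) [Membership P L] [Fintype P] [Fintype L]
    [Configuration.ProjectivePlane P L] [DecidableEq P] [DecidableEq L]
    [∀ (p : P) (l : L), Decidable (p ∈ l)] (q : ℕ)
    (hq : Configuration.ProjectivePlane.order P L = q)
    (F : Finset P) (hcard : F.card = q + 1) (p : P) (hp : p ∈ F)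
    (ht : {ℓ : L | IsTangentLine (F : Set P) ℓ p}.ncard = 2) :
    (Finset.univ.filter (fun l : L => p ∈ l ∧ (F.filter (fun x => x ∈ l)).card = 3)).card = 1 := by
  set A : Finset L := Finset.univ.filter (fun l => p ∈ l) with hA
  set g : L → ℕ := fun l => ((F.erase p).filter (fun x => x ∈ l)).card with hg
  have hfg : ∀ l ∈ A, (F.filter (fun x => x ∈ l)).card = g l + 1 := by
    intro l hl
    have hl' : p ∈ l := by simpa [hA] using hl
    rw [hg]
    simp only
    rw [Finset.filter_erase, Finset.card_erase_add_one]
    simp [hp, hl']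
  have hAc : A.card = q + 1 := by
    have h := ProjectivePlane.lineCount_eq (P := P) (L := L) p
    rw [hq, lineCount, Nat.card_eq_fintype_card, Fintype.card_subtype] at h
    exact h
  have hz : (A.filter (fun l => g l = 0)).card = 2 := by
    rw [← ht, ← Set.ncard_coe_finset]
    congr 1
    ext l
    simp only [hA, hg, IsTangentLine, Finset.coe_filter, Finset.mem_filter, Finset.mem_univ,
      true_and, Set.mem_ofPred_eq, Finset.card_eq_zero, Finset.filter_eq_empty_iff,
      Finset.mem_erase, Set.ext_iff, Set.mem_inter_iff, Finset.mem_coe, Set.mem_singleton_iff]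
    constructor
    · rintro ⟨h1, h2⟩ x
      constructor
      · rintro ⟨h3, h4⟩
        by_contra h5
        exact h2 ⟨h5, h3⟩ h4
      · rintro rfl
        exact ⟨hp, h1⟩
    · intro h
      refine ⟨((h p).2 rfl).2, ?_⟩
      rintro x ⟨h1, h2⟩ h3
      exact h1 ((h x).1 ⟨h2, h3⟩)
  have hs : ∑ l ∈ A, g l = q := by
    have h := Finset.sum_card_bipartiteAbove_eq_sum_card_bipartiteBelow
      (s := A) (t := F.erase p) (fun (l : L) (x : P) => x ∈ l)
    simp only [Finset.bipartiteAbove, Finset.bipartiteBelow] at h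
    rw [hg]
    simp only
    rw [h, Finset.sum_congr rfl (g := fun _ => 1)]
    · simp [Finset.card_erase_of_mem hp, hcard]
    · intro x hx
      obtain ⟨l, hl, hu⟩ := HasLines.existsUnique_line P L p x (Finset.ne_of_mem_erase hx).symm
      rw [Finset.card_eq_one]
      refine ⟨l, ?_⟩
      ext m
      simp only [hA, Finset.mem_filter, Finset.mem_univ, true_and, Finset.mem_singleton]
      exact ⟨fun h => hu m h, fun h => h ▸ hl⟩
  have hh : ∑ l ∈ A, (g l - 1) = 1 := by
    have h1 : ∑ l ∈ A, (g l + if g l = 0 then 1 else 0) = ∑ l ∈ A, ((g l - 1) + 1) := by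
      refine Finset.sum_congr rfl fun l _ => ?_
      split_ifs <;> omega
    rw [Finset.sum_add_distrib, Finset.sum_add_distrib, ← Finset.card_filter, hz, hs] at h1
    simp only [Finset.sum_const, hAc, smul_eq_mul, mul_one] at h1
    omega
  obtain ⟨l, hl, hl0⟩ : ∃ l ∈ A, g l - 1 ≠ 0 := Finset.exists_ne_zero_of_sum_ne_zero (by omega)
  have hsplit := Finset.add_sum_erase A (fun l => g l - 1) hl
  have hrest : ∑ m ∈ A.erase l, (g m - 1) = 0 := by omega
  rw [Finset.sum_eq_zero_iff] at hrest
  rw [Finset.card_eq_one]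
  refine ⟨l, ?_⟩
  ext m
  simp only [Finset.mem_filter, Finset.mem_univ, true_and, Finset.mem_singleton]
  constructor
  · rintro ⟨hm, hm3⟩
    by_contra hne
    have hmA : m ∈ A := by simpa [hA] using hm
    have := hrest m (Finset.mem_erase.2 ⟨hne, hmA⟩)
    have := hfg m hmA
    omega
  · rintro rfl
    refine ⟨by simpa [hA] using hl, ?_⟩
    rw [hfg m hl]
    omega

/-- If a finite projective plane of order `q` contains a 2-semiarc of size `q + 1`,
then `3` divides `q + 1`. -/
theorem two_semiarc_size_q_add_one (P L : Type*) [Membership P L] [Fintype P] [Fintype L]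
    [Configuration.ProjectivePlane P L] (q : ℕ)
    (hq : Configuration.ProjectivePlane.order P L = q)
    (S : Set P) (hS : IsSemiarc P L 2 S) (hcard : S.ncard = q + 1) :
    3 ∣ q + 1 := by
  classical
  obtain ⟨F, rfl⟩ : ∃ F : Finset P, (F : Set P) = S := ⟨S.toFinset, by simp⟩
  rw [Set.ncard_coe_finset] at hcard
  have h := Finset.sum_card_bipartiteAbove_eq_sum_card_bipartiteBelow
    (s := F) (t := Finset.univ.filter (fun l : L => (F.filter (fun x => x ∈ l)).card = 3))
    (fun (x : P) (l : L) => x ∈ l)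
  simp only [Finset.bipartiteAbove, Finset.bipartiteBelow] at h
  have h3 : ∀ l ∈ Finset.univ.filter (fun l : L => (F.filter (fun x => x ∈ l)).card = 3),
      (F.filter (fun x => x ∈ l)).card = 3 := fun l hl => (Finset.mem_filter.1 hl).2
  rw [Finset.sum_congr rfl h3, Finset.sum_congr rfl (g := fun _ => 1)] at h
  · simp only [Finset.sum_const, smul_eq_mul, mul_one] at h
    exact ⟨_, by rw [← hcard, h, mul_comm]⟩
  · intro p hp
    rw [← two_semiarc_key P L q hq F hcard p hp (hS.2 p hp), Finset.filter_filter]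
    congr 1
    ext l
    simp [and_comm]
end

section
/- Let S be a 2-semiarc of size q + 2 in a finite projective plane of order q. Then there exist natural numbers α and β with β ≠ 1 such that q + 2 = 4α + 3β. -/
open Finset in
theorem two_semiarc_size_q_add_two (P L : Type*) [Membership P L] [Fintype P] [Fintype L]
    [Configuration.ProjectivePlane P L] (q : ℕ)
    (hq : Configuration.ProjectivePlane.order P L = q)
    (S : Set P) (hS : IsSemiarc P L 2 S) (hcard : S.ncard = q + 2) :
    ∃ α β : ℕ, β ≠ 1 ∧ q + 2 = 4 * α + 3 * β := by
  classical
  obtain ⟨-, hT⟩ := hS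
  set s : Finset P := S.toFinset with hs
  have hmem : ∀ x, x ∈ s ↔ x ∈ S := by simp [hs]
  have hsc : s.card = q + 2 := by rw [← hcard, hs, Set.ncard_eq_toFinset_card']
  let c : L → ℕ := fun l => (s.filter (fun x => x ∈ l)).card
  let n : ℕ → P → ℕ := fun k p => (univ.filter (fun l : L => c l = k ∧ p ∈ l)).card
  let M : ℕ → ℕ := fun k => (univ.filter (fun l : L => c l = k)).card
  -- local count at a point
  have key : ∀ p ∈ s, n 3 p + 2 * n 4 p = 2 := by
    intro p hp
    let Lp : Finset L := univ.filter (fun l => p ∈ l)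
    have h1 : Lp.card = q + 1 := by
      have := Configuration.ProjectivePlane.lineCount_eq (P := P) (L := L) p
      rw [hq, Configuration.lineCount, Nat.card_eq_fintype_card, Fintype.card_subtype] at this
      exact this
    have h2 : (Lp.filter (fun l => c l = 1)).card = 2 := by
      rw [← hT p ((hmem p).1 hp), Set.ncard_eq_toFinset_card']
      congr 1
      ext l
      rw [Set.mem_toFinset]
      change _ ↔ S ∩ {x | x ∈ l} = {p}
      simp only [Lp, c, mem_filter, mem_univ, true_and]
      constructor
      · rintro ⟨hpl, h⟩
        obtain ⟨a, ha⟩ := card_eq_one.1 h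
        have : p ∈ s.filter (fun x => x ∈ l) := by simp [hp, hpl]
        rw [ha, mem_singleton] at this
        subst this
        ext x
        have := congrArg (x ∈ ·) ha
        simp only [mem_filter, mem_singleton, hmem] at this
        simpa using this
      · intro h
        have hx : ∀ x, (x ∈ S ∧ x ∈ l) ↔ x = p := fun x => by
          have := congrArg (x ∈ ·) h
          simpa using this
        refine ⟨((hx p).2 rfl).2, card_eq_one.2 ⟨p, ?_⟩⟩
        ext x
        simp [hmem, hx]
    have h3 : ∑ l ∈ Lp, (c l - 1) = q + 1 := by
      have e1 : ∀ l ∈ Lp, c l - 1 = (bipartiteAbove (fun (l : L) (x : P) => x ∈ l) (s.erase p) l).card := by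
        intro l hl
        have hpl : p ∈ l := by simpa [Lp] using hl
        rw [bipartiteAbove, filter_erase, card_erase_of_mem (by simp [hp, hpl])]
      rw [sum_congr rfl e1, sum_card_bipartiteAbove_eq_sum_card_bipartiteBelow]
      have e2 : ∀ x ∈ s.erase p, (bipartiteBelow (fun (l : L) (x : P) => x ∈ l) Lp x).card = 1 := by
        intro x hx
        obtain ⟨l, hl, hu⟩ := Configuration.HasLines.existsUnique_line P L p x (ne_of_mem_erase hx).symm
        refine card_eq_one.2 ⟨l, ?_⟩
        ext m
        simp only [bipartiteBelow, Lp, mem_filter, mem_univ, true_and, mem_singleton]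
        exact ⟨fun h => hu m h, fun h => h ▸ hl⟩
      rw [sum_congr rfl e2]
      simp [card_erase_of_mem hp, hsc]
    have hpos : ∀ l ∈ Lp, 1 ≤ c l := by
      intro l hl
      have hpl : p ∈ l := by simpa [Lp] using hl
      exact card_pos.2 ⟨p, by simp [hp, hpl]⟩
    have h4 : ∑ l ∈ Lp, (c l - 2) = 2 := by
      have : ∑ l ∈ Lp, (c l - 1) + (Lp.filter (fun l => c l = 1)).card
          = ∑ l ∈ Lp, (c l - 2) + Lp.card := by
        rw [card_filter, card_eq_sum_ones, ← sum_add_distrib, ← sum_add_distrib]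
        refine sum_congr rfl fun l hl => ?_
        have := hpos l hl
        split_ifs <;> omega
      omega
    have h5 : ∑ l ∈ Lp, (c l - 2) = n 3 p + 2 * n 4 p := by
      have e : ∀ k, n k p = (Lp.filter (fun l => c l = k)).card := by
        intro k
        simp only [n, Lp, filter_filter]
        congr 1
        ext l
        simp [and_comm]
      rw [e, e, card_filter, card_filter, mul_sum, ← sum_add_distrib]
      refine sum_congr rfl fun l hl => ?_
      have : c l - 2 ≤ ∑ l ∈ Lp, (c l - 2) :=
        single_le_sum (f := fun l => c l - 2) (fun _ _ => Nat.zero_le _) hl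
      split_ifs <;> have := hpos l hl <;> omega
    omega
  -- global count
  have glob : ∀ k, ∑ p ∈ s, n k p = k * M k := by
    intro k
    have : ∀ p ∈ s, n k p = (bipartiteAbove (fun (p : P) (l : L) => p ∈ l)
        (univ.filter (fun l : L => c l = k)) p).card := by
      intro p _
      simp [n, bipartiteAbove, filter_filter]
    rw [sum_congr rfl this, sum_card_bipartiteAbove_eq_sum_card_bipartiteBelow]
    have e2 : ∀ l ∈ univ.filter (fun l : L => c l = k),
        (bipartiteBelow (fun (p : P) (l : L) => p ∈ l) s l).card = k := by
      intro l hl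
      exact (mem_filter.1 hl).2
    rw [sum_congr rfl e2]
    simp [M, mul_comm]
  have total : 3 * M 3 + 8 * M 4 = 2 * (q + 2) := by
    have := sum_congr rfl key
    rw [sum_add_distrib, ← mul_sum, glob, glob] at this
    simp only [sum_const, smul_eq_mul, hsc] at this
    omega
  refine ⟨M 4, M 3 / 2, ?_, by omega⟩
  intro hβ
  have hM : M 3 = 2 := by omega
  obtain ⟨l, m, hlm, he⟩ := card_eq_two.1 hM
  have hl : c l = 3 := by
    have : l ∈ univ.filter (fun l : L => c l = 3) := by simp [he]
    exact (mem_filter.1 this).2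
  have hsub : ∀ p ∈ s, p ∈ l → p ∈ m := by
    intro p hp hpl
    have h1 : 0 < n 3 p := card_pos.2 ⟨l, by simp [hl, hpl]⟩
    have h2 : n 3 p = 2 := by have := key p hp; omega
    have h3 : univ.filter (fun l : L => c l = 3 ∧ p ∈ l) = univ.filter (fun l : L => c l = 3) := by
      apply eq_of_subset_of_card_le
      · intro x; simp only [mem_filter]; tauto
      · exact (hM.trans h2.symm).le
    have h4 : m ∈ univ.filter (fun l : L => c l = 3 ∧ p ∈ l) := by rw [h3, he]; simp
    exact (mem_filter.1 h4).2.2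
  have hl' : 1 < (s.filter (fun x => x ∈ l)).card := by
    change 1 < c l
    omega
  obtain ⟨a, ha, b, hb, hab⟩ := one_lt_card.1 hl'
  rw [mem_filter] at ha hb
  rcases Configuration.Nondegenerate.eq_or_eq ha.2 hb.2 (hsub a ha.1 ha.2) (hsub b hb.1 hb.2) with h | h
  · exact hab h
  · exact hlm h
end

section
/- Let S be a 2-semiarc in a finite projective plane of order 2. Then S is a set of two or three collinear points: there exists a line ℓ with S ⊆ ℓ and |S| ∈ {2, 3}. -/
/-- In a finite projective plane of order 2, every 2-semiarc is a set of two or three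
collinear points. -/
theorem two_semiarc_order_two (P L : Type*) [Membership P L] [Fintype P] [Fintype L]
    [Configuration.ProjectivePlane P L]
    (hq : Configuration.ProjectivePlane.order P L = 2)
    (S : Set P) (hS : IsSemiarc P L 2 S) :
    ∃ ℓ : L, (∀ p ∈ S, p ∈ ℓ) ∧ S.ncard ∈ ({2, 3} : Set ℕ) := by 
  classical
  obtain ⟨⟨p, hp⟩, hT⟩ := hS
  have hTp := hT p hp
  have hA : {l : L | p ∈ l}.ncard = 3 := by
    have h := Configuration.ProjectivePlane.lineCount_eq (P := P) (L := L) p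
    rw [hq] at h
    exact h
  have hsub : {ℓ : L | IsTangentLine S ℓ p} ⊆ {l : L | p ∈ l} := by
    intro l hl
    have h1 : p ∈ S ∩ {x | x ∈ l} := by
      rw [show S ∩ {x | x ∈ l} = {p} from hl]
      rfl
    exact h1.2
  have hd : ({l : L | p ∈ l} \ {ℓ : L | IsTangentLine S ℓ p}).ncard = 1 := by
    have h := Set.ncard_sdiff_add_ncard_of_subset hsub (Set.toFinite _)
    omega
  obtain ⟨m, hm⟩ := Set.ncard_eq_one.mp hd
  have hm' : m ∈ {l : L | p ∈ l} \ {ℓ : L | IsTangentLine S ℓ p} := by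
    rw [hm]
    rfl
  obtain ⟨hpm, hmT⟩ := hm'
  have hpm : p ∈ m := hpm
  have hSm : ∀ q ∈ S, q ∈ m := by
    intro q hqS
    by_cases hqp : p = q
    · exact hqp ▸ hpm
    obtain ⟨l, ⟨hpl, hql⟩, -⟩ := Configuration.HasLines.existsUnique_line P L p q hqp
    have hl : l ∈ {l : L | p ∈ l} \ {ℓ : L | IsTangentLine S ℓ p} := by
      refine ⟨hpl, fun ht => hqp ?_⟩
      have h1 : q ∈ S ∩ {x | x ∈ l} := ⟨hqS, hql⟩
      rw [show S ∩ {x | x ∈ l} = {p} from ht] at h1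
      exact h1.symm
    rw [hm] at hl
    have hlm : l = m := hl
    exact hlm ▸ hql
  refine ⟨m, hSm, ?_⟩
  have hle : S.ncard ≤ 3 := by
    have h := Configuration.ProjectivePlane.pointCount_eq (P := P) (L := L) m
    rw [hq] at h
    have h3 : {x : P | x ∈ m}.ncard = 3 := h
    rw [← h3]
    exact Set.ncard_le_ncard hSm (Set.toFinite _)
  have hpos : 0 < S.ncard := (Set.ncard_pos (Set.toFinite _)).mpr ⟨p, hp⟩
  have hne : S.ncard ≠ 1 := by
    intro h1
    obtain ⟨a, ha⟩ := Set.ncard_eq_one.mp h1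
    apply hmT
    have hpa : p = a := by
      rw [ha] at hp
      exact hp
    change S ∩ {x | x ∈ m} = {p}
    rw [show S ∩ {x | x ∈ m} = S from Set.inter_eq_left.mpr hSm, ha, hpa]
  simp only [Set.mem_insert_iff, Set.mem_singleton_iff]
  omega
end

section
/- Let S be a 2-semiarc in a finite projective plane of order 3. Then S is a set of three non-collinear points: |S| = 3 and no line contains all of S. -/
open Configuration in
lemma nontangent_ncard {P L : Type*} [Membership P L] [Fintype P] [Fintype L]
    [Configuration.ProjectivePlane P L]
    (hq : Configuration.ProjectivePlane.order P L = 3)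
    (S : Set P) (hS : IsSemiarc P L 2 S) (p : P) (hp : p ∈ S) :
    {ℓ : L | p ∈ ℓ ∧ ∃ x ∈ S, x ≠ p ∧ x ∈ ℓ}.ncard = 2 := by
  have h1 := hS.2 p hp
  have h2 : {ℓ : L | p ∈ ℓ}.ncard = 4 := by
    have := ProjectivePlane.lineCount_eq (P := P) (L := L) p
    rw [hq] at this
    exact this
  have hsub : {ℓ : L | IsTangentLine S ℓ p} ⊆ {ℓ : L | p ∈ ℓ} := by
    intro ℓ h
    have : p ∈ S ∩ {x | x ∈ ℓ} := by
      rw [show S ∩ {x | x ∈ ℓ} = {p} from h]; rfl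
    exact this.2
  have h3 := Set.ncard_sdiff_add_ncard_of_subset hsub (Set.toFinite _)
  have h4 : {ℓ : L | p ∈ ℓ ∧ ∃ x ∈ S, x ≠ p ∧ x ∈ ℓ} =
      {ℓ : L | p ∈ ℓ} \ {ℓ : L | IsTangentLine S ℓ p} := by
    ext ℓ
    simp only [Set.mem_setOf_eq, Set.mem_sdiff, IsTangentLine]
    refine and_congr_right fun hpl => ⟨?_, ?_⟩
    · rintro ⟨x, hx, hne, hxl⟩ h
      have : x ∈ S ∩ {x | x ∈ ℓ} := ⟨hx, hxl⟩
      rw [h] at this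
      exact hne this
    · intro h
      by_contra hc
      push Not at hc
      apply h
      ext x
      constructor
      · rintro ⟨hx, hxl⟩
        by_contra hne
        exact hc x hx hne hxl
      · rintro rfl
        exact ⟨hp, hpl⟩
  rw [h4]
  omega

open Configuration in
lemma semiarc_key {P L : Type*} [Membership P L] [Fintype P] [Fintype L]
    [Configuration.ProjectivePlane P L]
    (hq : Configuration.ProjectivePlane.order P L = 3)
    (S : Set P) (hS : IsSemiarc P L 2 S) {p q r x : P} {a b : L} (hab : a ≠ b)
    (hp : p ∈ S) (hqS : q ∈ S) (hr : r ∈ S) (hx : x ∈ S)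
    (hqp : q ≠ p) (hrp : r ≠ p) (hxp : x ≠ p)
    (hpa : p ∈ a) (hpb : p ∈ b) (hqa : q ∈ a) (hrb : r ∈ b) (hxb : x ∈ b) : x = r := by
  by_contra hxr
  have hqb : q ∉ b := fun h =>
    (Nondegenerate.eq_or_eq hqa hpa h hpb).elim hqp hab
  have hqr : q ≠ r := fun h => hqb (h ▸ hrb)
  have hqx : q ≠ x := fun h => hqb (h ▸ hxb)
  have hc := nontangent_ncard hq S hS q hqS
  obtain ⟨m, hm⟩ : ∃ m : L, q ∈ m ∧ r ∈ m := ⟨_, HasLines.mkLine_ax hqr⟩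
  obtain ⟨n, hn⟩ : ∃ n : L, q ∈ n ∧ x ∈ n := ⟨_, HasLines.mkLine_ax hqx⟩
  have key : ∀ {y z : P} {l : L}, y ∈ b → z ∈ b → y ≠ z → q ∈ l → y ∈ l → z ∈ l → False := by
    intro y z l hy hz hyz hl1 hl2 hl3
    rcases Nondegenerate.eq_or_eq hl2 hl3 hy hz with h | h
    · exact hyz h
    · exact hqb (h ▸ hl1)
  have ham : a ≠ m := by
    rintro rfl
    exact key hpb hrb hrp.symm hqa hpa hm.2
  have han : a ≠ n := by
    rintro rfl
    exact key hpb hxb hxp.symm hqa hpa hn.2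
  have hmn : m ≠ n := by
    rintro rfl
    exact key hrb hxb (Ne.symm hxr) hm.1 hm.2 hn.2
  have hsub : ({a, m, n} : Set L) ⊆ {ℓ : L | q ∈ ℓ ∧ ∃ x ∈ S, x ≠ q ∧ x ∈ ℓ} := by
    rintro l (rfl | rfl | rfl)
    · exact ⟨hqa, p, hp, hqp.symm, hpa⟩
    · exact ⟨hm.1, r, hr, hqr.symm, hm.2⟩
    · exact ⟨hn.1, x, hx, hqx.symm, hn.2⟩
  have h := Set.ncard_le_ncard hsub (Set.toFinite _)
  rw [hc, Set.ncard_eq_three.2 ⟨a, m, n, ham, han, hmn, rfl⟩] at h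
  omega

/-- In a finite projective plane of order 3, every 2-semiarc is a set of three
non-collinear points. -/
theorem two_semiarc_order_three (P L : Type*) [Membership P L] [Fintype P] [Fintype L]
    [Configuration.ProjectivePlane P L]
    (hq : Configuration.ProjectivePlane.order P L = 3)
    (S : Set P) (hS : IsSemiarc P L 2 S) :
    S.ncard = 3 ∧ ¬ ∃ ℓ : L, ∀ p ∈ S, p ∈ ℓ := by
  obtain ⟨p, hp⟩ := hS.1
  obtain ⟨a, b, hab, hN⟩ := Set.ncard_eq_two.1 (nontangent_ncard hq S hS p hp)
  have ha : a ∈ {ℓ : L | p ∈ ℓ ∧ ∃ x ∈ S, x ≠ p ∧ x ∈ ℓ} := by rw [hN]; simp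
  have hb : b ∈ {ℓ : L | p ∈ ℓ ∧ ∃ x ∈ S, x ≠ p ∧ x ∈ ℓ} := by rw [hN]; simp
  obtain ⟨hpa, q, hqS, hqp, hqa⟩ := ha
  obtain ⟨hpb, r, hr, hrp, hrb⟩ := hb
  have hqb : q ∉ b := fun h =>
    (Configuration.Nondegenerate.eq_or_eq hqa hpa h hpb).elim hqp hab
  have hqr : q ≠ r := fun h => hqb (h ▸ hrb)
  have hSeq : S = {p, q, r} := by
    ext x
    constructor
    · intro hx
      by_cases hxp : x = p
      · simp [hxp]
      obtain ⟨l, hl⟩ : ∃ l : L, x ∈ l ∧ p ∈ l := ⟨_, Configuration.HasLines.mkLine_ax hxp⟩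
      have hmem : l ∈ {ℓ : L | p ∈ ℓ ∧ ∃ x ∈ S, x ≠ p ∧ x ∈ ℓ} := ⟨hl.2, x, hx, hxp, hl.1⟩
      rw [hN] at hmem
      rcases hmem with rfl | h
      · have := semiarc_key hq S hS hab.symm hp hr hqS hx hrp hqp hxp hpb hpa hrb hqa hl.1
        simp [this]
      · have h : l = b := h
        subst h
        have := semiarc_key hq S hS hab hp hqS hr hx hqp hrp hxp hpa hpb hqa hrb hl.1
        simp [this]
    · rintro (rfl | rfl | rfl) <;> assumption
  refine ⟨Set.ncard_eq_three.2 ⟨p, q, r, hqp.symm, hrp.symm, hqr, hSeq⟩, ?_⟩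
  rintro ⟨l, hl⟩
  have h1 := (Configuration.Nondegenerate.eq_or_eq hqa hpa (hl q hqS) (hl p hp)).resolve_left hqp
  have h2 := (Configuration.Nondegenerate.eq_or_eq hrb hpb (hl r hr) (hl p hp)).resolve_left hrp
  exact hab (h1.trans h2.symm)
end

section
/- Let S be a 2-semiarc in a finite projective plane of order 4. Then |S| ∈ {4, 6, 7}. -/
open Finset in
/-- In a finite projective plane of order 4, every 2-semiarc has size 4, 6 or 7. -/
theorem two_semiarc_order_four (P L : Type*) [Membership P L] [Fintype P] [Fintype L]
    [Configuration.ProjectivePlane P L]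
    (hq : Configuration.ProjectivePlane.order P L = 4)
    (S : Set P) (hS : IsSemiarc P L 2 S) :
    S.ncard ∈ ({4, 6, 7} : Set ℕ) := by
  classical
  obtain ⟨⟨p0, hp0⟩, hS⟩ := hS
  obtain ⟨T, rfl⟩ : ∃ T : Finset P, (T : Set P) = S := ⟨S.toFinset, by simp⟩
  rw [Set.ncard_coe_finset]
  have hp0 : p0 ∈ T := by simpa using hp0
  -- number of points of `T` on a line
  let k : L → ℕ := fun l => #{x ∈ T | x ∈ l}
  let A : P → Finset L := fun p => {l : L | p ∈ l ∧ 2 ≤ k l}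
  have key : ∀ {a b : P} {l m : L}, a ∈ l → b ∈ l → a ∈ m → b ∈ m → a ≠ b → l = m := by
    intro a b l m h1 h2 h3 h4 hab
    exact (Configuration.Nondegenerate.eq_or_eq h1 h2 h3 h4).resolve_left hab
  have htan : ∀ p ∈ T, ∀ l : L, IsTangentLine (T : Set P) l p ↔ (p ∈ l ∧ ¬ 2 ≤ k l) := by
    intro p hp l
    unfold IsTangentLine
    have e : ((T : Set P) ∩ {x | x ∈ l}) = (({x ∈ T | x ∈ l} : Finset P) : Set P) := by
      ext x; simp
    rw [e, ← Finset.coe_singleton, Finset.coe_inj]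
    constructor
    · intro h
      have : p ∈ ({x ∈ T | x ∈ l} : Finset P) := by rw [h]; simp
      refine ⟨(Finset.mem_filter.1 this).2, ?_⟩
      simp only [k]
      rw [h]; simp
    · rintro ⟨h1, h2⟩
      have hm : p ∈ ({x ∈ T | x ∈ l} : Finset P) := by simp [hp, h1]
      symm
      apply Finset.eq_of_subset_of_card_le (by simpa using ⟨hp, h1⟩)
      simp only [k] at h2
      rw [Finset.card_singleton]
      omega
  have hA : ∀ p ∈ T, #(A p) = 3 := by
    intro p hp
    have h1 := hS p (by simpa using hp)
    have e : {l : L | IsTangentLine (T : Set P) l p}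
        = (({l : L | p ∈ l ∧ ¬ 2 ≤ k l} : Finset L) : Set L) := by
      ext l; simp [htan p hp l]
    rw [e, Set.ncard_coe_finset] at h1
    have h2 : #({l : L | p ∈ l} : Finset L) = 5 := by
      have := Configuration.ProjectivePlane.lineCount_eq (L := L) p
      rw [hq, Configuration.lineCount, Nat.card_eq_fintype_card, Fintype.card_subtype] at this
      exact this
    have h3 := Finset.card_filter_add_card_filter_not (s := ({l : L | p ∈ l} : Finset L))
      (fun l => 2 ≤ k l)
    rw [Finset.filter_filter, Finset.filter_filter] at h3
    simp only [A]
    omega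
  have hsum : ∀ p ∈ T, ∑ l ∈ A p, (k l - 1) = #T - 1 := by
    intro p hp
    rw [← Finset.card_erase_of_mem hp]
    have : T.erase p = (A p).biUnion (fun l => ({x ∈ T | x ∈ l} : Finset P).erase p) := by
      ext x
      simp only [Finset.mem_erase, Finset.mem_biUnion, Finset.mem_filter]
      constructor
      · rintro ⟨hx, hxT⟩
        have hl := Configuration.HasLines.mkLine_ax (L := L) hx
        refine ⟨Configuration.HasLines.mkLine hx, ?_, hx, hxT, hl.1⟩
        simp only [A, Finset.mem_filter, Finset.mem_univ, true_and]
        refine ⟨hl.2, ?_⟩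
        have : ({x, p} : Finset P) ⊆ {y ∈ T | y ∈ (Configuration.HasLines.mkLine hx : L)} := by
          intro y hy
          simp only [Finset.mem_insert, Finset.mem_singleton] at hy
          rcases hy with rfl | rfl <;> simp [hl, hp, hxT]
        have := Finset.card_le_card this
        rwa [Finset.card_pair hx] at this
      · rintro ⟨l, -, h1, h2, -⟩
        exact ⟨h1, h2⟩
    rw [this, Finset.card_biUnion]
    · apply Finset.sum_congr rfl
      intro l hl
      simp only [A, Finset.mem_filter, Finset.mem_univ, true_and] at hl
      rw [Finset.card_erase_of_mem (by simp [hp, hl.1])]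
    · intro l hl m hm hlm
      simp only [A, Finset.mem_filter, Finset.mem_univ, true_and, Finset.mem_coe] at hl hm
      refine Finset.disjoint_left.2 ?_
      intro x hx hx'
      simp only [Finset.mem_erase, Finset.mem_filter] at hx hx'
      exact hlm (key hx.2.2 hl.1 hx'.2.2 hm.1 hx.1)
  have hk3 : ∀ l, k l ≤ 3 := by
    intro l
    by_contra hl
    by_cases hsub : ∀ x ∈ T, x ∈ l
    · have : A p0 ⊆ {l} := by
        intro m hm
        simp only [A, Finset.mem_filter, Finset.mem_univ, true_and] at hm
        obtain ⟨a, ha, b, hb, hab⟩ := Finset.one_lt_card.1 (show 1 < #{x ∈ T | x ∈ m} from hm.2)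
        simp only [Finset.mem_filter] at ha hb
        simp [key ha.2 hb.2 (hsub a ha.1) (hsub b hb.1) hab]
      have := Finset.card_le_card this
      rw [hA p0 hp0] at this
      simp at this
    · push Not at hsub
      obtain ⟨q, hqT, hql⟩ := hsub
      have hne : ∀ x, x ∈ l → x ≠ q := by rintro x hx rfl; exact hql hx
      have : k l ≤ #(A q) := by
        let f : P → L := fun x => if h : x ≠ q then Configuration.HasLines.mkLine h else l
        have hf : ∀ x, x ∈ l → x ∈ f x ∧ q ∈ f x := by
          intro x hx
          simp only [f, dif_pos (hne x hx)]
          exact Configuration.HasLines.mkLine_ax (L := L) (hne x hx)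
        apply Finset.card_le_card_of_injOn f
        · intro x hx
          simp only [Finset.coe_filter, Set.mem_ofPred_eq] at hx
          simp only [A, Finset.coe_filter, Finset.mem_univ, true_and, Set.mem_ofPred_eq]
          refine ⟨(hf x hx.2).2, ?_⟩
          apply Finset.one_lt_card.2
          exact ⟨x, by simp [hx.1, (hf x hx.2).1], q, by simp [hqT, (hf x hx.2).2], hne x hx.2⟩
        · intro x hx y hy hxy
          simp only [Finset.coe_filter, Set.mem_ofPred_eq] at hx hy
          by_contra hne'
          have h1 := hf x hx.2
          have h2 := hf y hy.2
          rw [← hxy] at h2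
          exact hql ((key h1.1 h2.1 hx.2 hy.2 hne') ▸ h1.2)
      rw [hA q hqT] at this
      omega
  have hlow : 3 ≤ #T - 1 := by
    rw [← hsum p0 hp0, ← hA p0 hp0, Finset.card_eq_sum_ones]
    apply Finset.sum_le_sum
    intro l hl
    simp only [A, Finset.mem_filter, Finset.mem_univ, true_and] at hl
    omega
  have hup : #T - 1 ≤ 6 := by
    rw [← hsum p0 hp0]
    have := Finset.sum_le_card_nsmul (A p0) (fun l => k l - 1) 2
      (fun l _ => by have := hk3 l; omega)
    rw [hA p0 hp0] at this
    simpa using this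
  have h5 : #T ≠ 5 := by
    intro h5
    have h1 : ∀ p ∈ T, #{l ∈ ({l : L | k l = 3} : Finset L) | p ∈ l} = 1 := by
      intro p hp
      have e : ({l ∈ ({l : L | k l = 3} : Finset L) | p ∈ l}) = {l ∈ A p | k l = 3} := by
        ext l
        simp only [A, Finset.mem_filter, Finset.mem_univ, true_and]
        constructor
        · rintro ⟨a, b⟩; exact ⟨⟨b, by omega⟩, a⟩
        · rintro ⟨⟨b, _⟩, a⟩; exact ⟨a, b⟩
      rw [e, Finset.card_filter]
      have h := hsum p hp
      have : ∑ l ∈ A p, (k l - 1) = ∑ l ∈ A p, (1 + if k l = 3 then 1 else 0) := by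
        apply Finset.sum_congr rfl
        intro l hl
        simp only [A, Finset.mem_filter, Finset.mem_univ, true_and] at hl
        have := hk3 l
        split_ifs <;> omega
      rw [this, Finset.sum_add_distrib, ← Finset.card_eq_sum_ones, hA p hp] at h
      omega
    have h2 := Finset.sum_card_bipartiteAbove_eq_sum_card_bipartiteBelow
      (s := T) (t := ({l : L | k l = 3} : Finset L)) (fun p l => p ∈ l)
    have h3 : ∑ p ∈ T, #(Finset.bipartiteAbove (fun (p : P) (l : L) => p ∈ l)
        ({l : L | k l = 3} : Finset L) p) = 5 := by
      refine (Finset.sum_congr rfl (g := fun _ => 1) (fun p hp => h1 p hp)).trans ?_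
      simpa using h5
    have h4 : ∑ l ∈ ({l : L | k l = 3} : Finset L),
        #(Finset.bipartiteBelow (fun (p : P) (l : L) => p ∈ l) T l)
        = #({l : L | k l = 3} : Finset L) * 3 := by
      refine (Finset.sum_congr rfl (g := fun _ => 3)
        (fun l hl => (Finset.mem_filter.1 hl).2)).trans ?_
      simp
    omega
  simp only [Set.mem_insert_iff, Set.mem_singleton_iff]
  omega
end

section
/- Let S be a 2-semiarc in PG(2,5), the Desarguesian projective plane over the field with 5 elements. Then |S| ∈ {5, 6, 9}. -/
noncomputable section

/-- Points of `PG(2,F)`: the projectivization of `F³`. -/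
abbrev PGPoint (F : Type*) [Field F] := Projectivization F (Fin 3 → F)

/-- Lines of `PG(2,F)`: the 2-dimensional linear subspaces of `F³`. -/
abbrev PGLine (F : Type*) [Field F] :=
  {W : Submodule F (Fin 3 → F) // Module.finrank F W = 2}

/-- A point lies on a line when its representative vectors belong to the subspace. -/
def PGMem {F : Type*} [Field F] (p : PGPoint F) (ℓ : PGLine F) : Prop :=
  p.submodule ≤ ℓ.1

/-- A line `ℓ` is a tangent to `S` at `p` if `S ∩ ℓ = {p}`. -/
def PGTangent {F : Type*} [Field F] (S : Set (PGPoint F)) (ℓ : PGLine F) (p : PGPoint F) :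
    Prop :=
  S ∩ {x | PGMem x ℓ} = {p}

/-- A 2-semiarc in `PG(2,F)`: a nonempty set of points such that through each of its points
there pass exactly 2 tangent lines. -/
def IsTwoSemiarc {F : Type*} [Field F] (S : Set (PGPoint F)) : Prop :=
  S.Nonempty ∧ ∀ p ∈ S, {ℓ : PGLine F | PGTangent S ℓ p}.ncard = 2

instance : Fact (Nat.Prime 5) := ⟨by norm_num⟩


namespace TwoSemiarcAux

abbrev K := ZMod 5
abbrev V := Fin 3 → ZMod 5

/-- normalized representatives of the 31 points -/
def vec (j : Fin 31) : V :=
  if j.1 < 25 then ![1, (j.1 / 5 : ℕ), (j.1 % 5 : ℕ)]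
  else if j.1 < 30 then ![0, 1, (j.1 - 25 : ℕ)] else ![0, 0, 1]

def dot (a x : V) : K := a 0 * x 0 + a 1 * x 1 + a 2 * x 2

/-- bit masks of the lines -/
def Lm : List ℕ := [2113929216, 50872848, 37884036, 42213640, 35719234, 1106247680, 537989392, 135531012, 269631560, 68690050, 1073773568, 270795920, 545784900, 71370248, 151127298, 1074757632, 138453072, 69255428, 553683080, 276861442, 1073742816, 75630640, 285286436, 136843304, 541343778, 1073741855, 539107841, 142688385, 273156353, 84152385, 34636833]

def inc (a k : Fin 31) : Bool := decide (dot (vec a) (vec k) = 0)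

def mask (a : Fin 31) : ℕ := Lm.getD a.1 0

theorem mask_bit : ∀ a k : Fin 31, (mask a).testBit k.1 = inc a k := by decide +kernel

theorem mask_lt : ∀ a : Fin 31, mask a < 2 ^ 31 := by decide +kernel

theorem Lm_eq : Lm = (List.finRange 31).map mask := by decide +kernel

theorem mask_inj : ∀ a b : Fin 31, mask a = mask b → a = b := by decide +kernel

theorem inc_symm (a b : Fin 31) : inc a b = inc b a := by
  unfold inc dot
  congr 1
  rw [mul_comm (vec a 0), mul_comm (vec a 1), mul_comm (vec a 2)]

theorem lines_thru : ∀ j : Fin 31,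
    (Finset.univ.filter (fun a : Fin 31 => inc a j = true)).card = 6 := by decide +kernel

theorem normalize' : ∀ x y z : K, (x = 0 ∧ y = 0 ∧ z = 0) ∨ ∃ j : Fin 31, ∃ c : K,
    c ≠ 0 ∧ x = c * vec j 0 ∧ y = c * vec j 1 ∧ z = c * vec j 2 := by decide +kernel

theorem vec_ne' : ∀ j : Fin 31, vec j 0 ≠ 0 ∨ vec j 1 ≠ 0 ∨ vec j 2 ≠ 0 := by decide +kernel

theorem vec_ne (j : Fin 31) : vec j ≠ 0 := by
  intro h
  have := vec_ne' j
  simp [h] at this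

theorem normalize (w : V) (hw : w ≠ 0) : ∃ j : Fin 31, ∃ c : K, c ≠ 0 ∧ w = c • vec j := by
  rcases normalize' (w 0) (w 1) (w 2) with h | ⟨j, c, hc, h0, h1, h2⟩
  · exfalso
    apply hw
    ext i
    fin_cases i
    · exact h.1
    · exact h.2.1
    · exact h.2.2
  · refine ⟨j, c, hc, ?_⟩
    ext i
    fin_cases i
    · exact h0
    · exact h1
    · exact h2

/-! ### The search -/

/-- the lines through each point -/
def Tm : List (List ℕ) :=
  [[1073741855, 539107841, 142688385, 273156353, 84152385, 34636833],
   [35719234, 68690050, 151127298, 276861442, 541343778, 1073741855],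
   [37884036, 135531012, 545784900, 69255428, 285286436, 1073741855],
   [42213640, 269631560, 71370248, 553683080, 136843304, 1073741855],
   [50872848, 537989392, 270795920, 138453072, 75630640, 1073741855],
   [1073742816, 75630640, 285286436, 136843304, 541343778, 34636833],
   [35719234, 269631560, 545784900, 138453072, 1073742816, 84152385],
   [37884036, 68690050, 270795920, 553683080, 1073742816, 142688385],
   [42213640, 537989392, 151127298, 69255428, 1073742816, 273156353],
   [50872848, 135531012, 71370248, 276861442, 1073742816, 539107841],
   [1073773568, 270795920, 545784900, 71370248, 151127298, 34636833],
   [35719234, 135531012, 1073773568, 553683080, 75630640, 273156353],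
   [37884036, 537989392, 1073773568, 276861442, 136843304, 84152385],
   [42213640, 68690050, 1073773568, 138453072, 285286436, 539107841],
   [50872848, 269631560, 1073773568, 69255428, 541343778, 142688385],
   [1074757632, 138453072, 69255428, 553683080, 276861442, 34636833],
   [35719234, 537989392, 71370248, 1074757632, 285286436, 142688385],
   [37884036, 269631560, 151127298, 1074757632, 75630640, 539107841],
   [42213640, 135531012, 270795920, 1074757632, 541343778, 84152385],
   [50872848, 68690050, 545784900, 1074757632, 136843304, 273156353],
   [1106247680, 537989392, 135531012, 269631560, 68690050, 34636833],
   [35719234, 1106247680, 270795920, 69255428, 136843304, 539107841],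
   [37884036, 1106247680, 71370248, 138453072, 541343778, 273156353],
   [42213640, 1106247680, 545784900, 276861442, 75630640, 142688385],
   [50872848, 1106247680, 151127298, 553683080, 285286436, 84152385],
   [2113929216, 50872848, 37884036, 42213640, 35719234, 34636833],
   [2113929216, 68690050, 71370248, 69255428, 75630640, 84152385],
   [2113929216, 135531012, 151127298, 138453072, 136843304, 142688385],
   [2113929216, 269631560, 270795920, 276861442, 285286436, 273156353],
   [2113929216, 537989392, 545784900, 553683080, 541343778, 539107841],
   [2113929216, 1106247680, 1073773568, 1074757632, 1073742816, 1073741855]]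

def tcount (M j : ℕ) : ℕ := (Tm.getD j []).countP (fun L => (L &&& M) == 2 ^ j)

theorem Tm_eq : ∀ j : Fin 31, Tm.getD j.1 [] = Lm.filter (fun L => L.testBit j.1) := by
  decide +kernel

theorem tcount_eq (M : ℕ) (j : Fin 31) :
    tcount M j.1 = Lm.countP (fun L => (L &&& M) == 2 ^ j.1) := by
  unfold tcount
  rw [Tm_eq, List.countP_filter]
  apply List.countP_congr
  intro L _
  simp only [Bool.and_eq_true, beq_iff_eq, and_iff_left_iff_imp]
  intro h
  have := congrArg (fun n => n.testBit j.1) h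
  simp only [Nat.testBit_and, Nat.testBit_two_pow, decide_true, Bool.and_eq_true] at this
  exact this.1

def bad (I U : ℕ) : Bool := (List.range 31).any fun j =>
  I.testBit j && (Nat.blt 2 (tcount U j) || Nat.blt (tcount I j) 2)

def size (M : ℕ) : ℕ := (List.finRange 31).countP (fun k => M.testBit k.1)

def okSize (M : ℕ) : Bool := size M == 5 || size M == 6 || size M == 9

def search : List ℕ → ℕ → ℕ → Bool
  | [], I, U => bad I U || (I == U && okSize I)
  | j :: js, I, U => bad I U || (search js (I ||| 2 ^ j) U && search js I (U ^^^ 2 ^ j))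

def Good (M : ℕ) : Prop := ∀ j < 31, M.testBit j = true → tcount M j = 2

def Sub (A B : ℕ) : Prop := ∀ k, A.testBit k = true → B.testBit k = true

theorem tan_mono {A B j L : ℕ} (h : Sub A B) (hj : A.testBit j = true)
    (hL : L &&& B = 2 ^ j) : L &&& A = 2 ^ j := by
  apply Nat.eq_of_testBit_eq
  intro k
  have hk := congrArg (fun n => n.testBit k) hL
  simp only [Nat.testBit_and, Nat.testBit_two_pow] at hk ⊢
  have := h k
  by_cases hjk : j = k
  · subst hjk
    simp_all
  · simp only [hjk, decide_false, Bool.and_eq_false_iff] at hk ⊢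
    rcases hk with hk | hk
    · exact Or.inl hk
    · right
      by_contra hc
      simp_all

theorem tcount_mono {A B j : ℕ} (h : Sub A B) (hj : A.testBit j = true) :
    tcount B j ≤ tcount A j := by
  unfold tcount
  apply List.countP_mono_left
  intro L _ hL
  simp only [beq_iff_eq] at hL ⊢
  exact tan_mono h hj hL

theorem bad_sound {M I U : ℕ} (hM : Good M) (h1 : Sub I M) (h2 : Sub M U) : bad I U = false := by
  by_contra hb
  simp only [Bool.not_eq_false] at hb
  unfold bad at hb
  rw [List.any_eq_true] at hb
  obtain ⟨j, hj, hb⟩ := hb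
  rw [List.mem_range] at hj
  simp only [Bool.and_eq_true, Bool.or_eq_true, Nat.blt_eq] at hb
  obtain ⟨hI, hb⟩ := hb
  have e := hM j hj (h1 j hI)
  have a1 := tcount_mono h1 hI
  have a2 := tcount_mono h2 (h1 j hI)
  omega

theorem search_sound {M : ℕ} (hM : Good M) : ∀ (l : List ℕ) (I U : ℕ), Sub I M → Sub M U →
    search l I U = true → okSize M = true := by
  intro l
  induction l with
  | nil =>
    intro I U h1 h2 h
    simp only [search, bad_sound hM h1 h2, Bool.false_or, Bool.and_eq_true, beq_iff_eq] at h
    obtain ⟨rfl, h⟩ := h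
    have : M = I := by
      apply Nat.eq_of_testBit_eq
      intro k
      have a := h1 k
      have b := h2 k
      rw [Bool.eq_iff_iff]
      exact ⟨b, a⟩
    rw [this]; exact h
  | cons j js ih =>
    intro I U h1 h2 h
    simp only [search, bad_sound hM h1 h2, Bool.false_or, Bool.and_eq_true] at h
    by_cases hj : M.testBit j = true
    · refine ih _ _ ?_ h2 h.1
      intro k hk
      rw [Nat.testBit_or, Nat.testBit_two_pow] at hk
      by_cases hjk : j = k
      · exact hjk ▸ hj
      · simp only [hjk, decide_false, Bool.or_false] at hk
        exact h1 k hk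
    · refine ih _ _ h1 ?_ h.2
      intro k hk
      rw [Nat.testBit_xor, Nat.testBit_two_pow]
      by_cases hjk : j = k
      · exact absurd (hjk ▸ hk) hj
      · simp only [hjk, decide_false, Bool.xor_false]
        exact h2 k hk

def order1 : List ℕ := [13, 14, 17, 19, 22, 23, 2, 3, 4, 7, 8, 9, 10, 11, 12, 15, 16, 18, 20, 21, 24, 27, 28, 29, 1, 5, 26]
def order2 : List ℕ := [1, 2, 3, 4, 5, 10, 15, 20, 26, 27, 28, 29]

def I2 : ℕ := 1107296257
def I1 : ℕ := 1107296321
def U2 : ℕ := 2115011647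

theorem search1 : search order1 I1 (2 ^ 31 - 1) = true := by decide +kernel
theorem search2 : search order2 I2 U2 = true := by decide +kernel

/-! ### Coordinates -/

def dotL (a : V) : V →ₗ[K] K where
  toFun x := dot a x
  map_add' x y := by simp only [dot, Pi.add_apply]; ring
  map_smul' c x := by simp only [dot, Pi.smul_apply, smul_eq_mul, RingHom.id_apply]; ring

theorem dotL_apply (a x : V) : dotL a x = dot a x := rfl

theorem dotL_ne (a : V) (ha : a ≠ 0) : dotL a ≠ 0 := by
  intro h
  apply ha
  have h0 := LinearMap.congr_fun h ![1, 0, 0]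
  have h1 := LinearMap.congr_fun h ![0, 1, 0]
  have h2 := LinearMap.congr_fun h ![0, 0, 1]
  simp [dotL_apply, dot] at h0 h1 h2
  ext i
  fin_cases i
  · exact h0
  · exact h1
  · exact h2

def pt (e : V ≃ₗ[K] V) (j : Fin 31) : PGPoint K :=
  Projectivization.mk K (e (vec j)) (by simpa using vec_ne j)

def fn (e : V ≃ₗ[K] V) (a : Fin 31) : V →ₗ[K] K := (dotL (vec a)).comp e.symm.toLinearMap

theorem fn_ne (e : V ≃ₗ[K] V) (a : Fin 31) : fn e a ≠ 0 := by
  intro h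
  apply dotL_ne _ (vec_ne a)
  ext1 x
  have := LinearMap.congr_fun h (e (Pi.single x 1))
  ext
  simpa [fn] using this

theorem finrank_ker (f : V →ₗ[K] K) (hf : f ≠ 0) : Module.finrank K (LinearMap.ker f) = 2 := by
  have := Module.Dual.finrank_ker_add_one_of_ne_zero (f := f) hf
  simp at this
  omega

def ln (e : V ≃ₗ[K] V) (a : Fin 31) : PGLine K := ⟨LinearMap.ker (fn e a), finrank_ker _ (fn_ne e a)⟩

theorem mem_mk (w : V) (hw : w ≠ 0) (ℓ : PGLine K) :
    PGMem (Projectivization.mk K w hw) ℓ ↔ w ∈ ℓ.1 := by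
  unfold PGMem
  rw [Projectivization.submodule_mk, Submodule.span_singleton_le_iff_mem]

theorem mem_iff (e : V ≃ₗ[K] V) (j a : Fin 31) : PGMem (pt e j) (ln e a) ↔ inc a j = true := by
  unfold pt
  rw [mem_mk]
  simp [ln, fn, inc, dotL_apply]

theorem inc_inj (a b : Fin 31) (h : ∀ k, inc a k = inc b k) : a = b := by
  apply mask_inj
  apply Nat.eq_of_testBit_eq
  intro k
  by_cases hk : k < 31
  · have := h ⟨k, hk⟩
    rwa [← mask_bit, ← mask_bit] at this
  · rw [Nat.testBit_lt_two_pow, Nat.testBit_lt_two_pow]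
    · exact lt_of_lt_of_le (mask_lt b) (Nat.pow_le_pow_right (by norm_num) (by omega))
    · exact lt_of_lt_of_le (mask_lt a) (Nat.pow_le_pow_right (by norm_num) (by omega))

theorem pt_inj (e : V ≃ₗ[K] V) : Function.Injective (pt e) := by
  intro i j h
  apply inc_inj
  intro k
  rw [inc_symm i, inc_symm j, Bool.eq_iff_iff, ← mem_iff e, ← mem_iff e, h]

theorem ln_inj (e : V ≃ₗ[K] V) : Function.Injective (ln e) := by
  intro i j h
  apply inc_inj
  intro k
  rw [Bool.eq_iff_iff, ← mem_iff e, ← mem_iff e, h]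

theorem mk_eq_pt (e : V ≃ₗ[K] V) (w : V) (hw : w ≠ 0) (j : Fin 31) (c : K) 
    (h : e.symm w = c • vec j) : Projectivization.mk K w hw = pt e j := by
  unfold pt
  rw [Projectivization.mk_eq_mk_iff']
  refine ⟨c, ?_⟩
  rw [← map_smul, ← h, LinearEquiv.apply_symm_apply]

theorem pt_surj (e : V ≃ₗ[K] V) : Function.Surjective (pt e) := by
  intro p
  induction p using Projectivization.ind with
  | h w hw =>
    obtain ⟨j, c, hc, h⟩ := normalize (e.symm w) (by simpa using hw)
    exact ⟨j, (mk_eq_pt e w hw j c h).symm⟩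

theorem ln_surj (e : V ≃ₗ[K] V) : Function.Surjective (ln e) := by
  rintro ⟨W, hW⟩
  have hlt : W < ⊤ := by
    rw [lt_top_iff_ne_top]
    rintro rfl
    simp at hW
  obtain ⟨f, hf, hle⟩ := Submodule.exists_le_ker_of_lt_top W hlt
  have hWf : W = LinearMap.ker f :=
    Submodule.eq_of_le_of_finrank_eq hle (by rw [hW, finrank_ker f hf])
  let a : V := fun i => f (e (Pi.single i 1))
  have hfa : ∀ x, f (e x) = dot a x := by
    intro x
    have : f.comp e.toLinearMap = dotL a := by
      ext i
      fin_cases i <;> simp [dotL_apply, dot, a]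
    exact LinearMap.congr_fun this x
  have ha : a ≠ 0 := by
    intro h
    apply hf
    ext1 i
    ext
    have := hfa (e.symm (Pi.single i 1))
    rw [h] at this
    simpa [dot] using this
  obtain ⟨j, c, hc, h⟩ := normalize a ha
  refine ⟨j, ?_⟩
  apply Subtype.ext
  change (ln e j).1 = W
  rw [hWf]
  ext x
  have hx := hfa (e.symm x)
  rw [LinearEquiv.apply_symm_apply, h] at hx
  have h2 : f x = c * dot (vec j) (e.symm x) := by
    rw [hx]; simp only [dot, Pi.smul_apply, smul_eq_mul]; ring
  simp [ln, fn, dotL_apply, h2, hc]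

def pmask (e : V ≃ₗ[K] V) (S : Set (PGPoint K)) : ℕ :=
  open Classical in Nat.ofBits (fun k : Fin 31 => decide (pt e k ∈ S))

theorem pmask_bit (e : V ≃ₗ[K] V) (S : Set (PGPoint K)) (k : Fin 31) :
    (pmask e S).testBit k.1 = true ↔ pt e k ∈ S := by
  unfold pmask
  rw [Nat.testBit_ofBits_lt _ _ k.2]
  simp

theorem pmask_bit_ge (e : V ≃ₗ[K] V) (S : Set (PGPoint K)) (k : ℕ) (hk : 31 ≤ k) :
    (pmask e S).testBit k = false := by
  unfold pmask
  rw [Nat.testBit_ofBits_ge _ _ hk]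

theorem tangent_iff (e : V ≃ₗ[K] V) (S : Set (PGPoint K)) (a j : Fin 31) :
    PGTangent S (ln e a) (pt e j) ↔ (mask a &&& pmask e S) = 2 ^ j.1 := by
  have h1 : PGTangent S (ln e a) (pt e j) ↔ 
      ∀ k : Fin 31, (pt e k ∈ S ∧ inc a k = true) ↔ k = j := by
    unfold PGTangent
    rw [Set.ext_iff, (pt_surj e).forall]
    simp only [Set.mem_inter_iff, Set.mem_ofPred_eq, mem_iff, Set.mem_singleton_iff, (pt_inj e).eq_iff]
  rw [h1]
  constructor
  · intro h
    apply Nat.eq_of_testBit_eq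
    intro k
    rw [Nat.testBit_and, Nat.testBit_two_pow]
    by_cases hk : k < 31
    · have := h ⟨k, hk⟩
      rw [← pmask_bit, ← mask_bit] at this
      rw [Bool.eq_iff_iff, Bool.and_eq_true, and_comm, decide_eq_true_iff]
      rw [this, Fin.ext_iff, eq_comm]
    · rw [pmask_bit_ge e S k (by omega)]
      have := j.2
      simp
      omega
  · intro h k
    have := congrArg (fun n => n.testBit k.1) h
    simp only [Nat.testBit_and, Nat.testBit_two_pow] at this
    rw [Bool.eq_iff_iff, Bool.and_eq_true, decide_eq_true_iff, pmask_bit, mask_bit] at this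
    rw [and_comm, this, Fin.ext_iff, eq_comm]

theorem countP_card (p : Fin 31 → Bool) :
    (List.finRange 31).countP p = (Finset.univ.filter (fun a => p a = true)).card := by
  rw [List.countP_eq_length_filter, Finset.card_def, Finset.filter_val, Fin.univ_def]
  simp

theorem ncard_lines (e : V ≃ₗ[K] V) (P : PGLine K → Prop) (p : Fin 31 → Bool)
    (h : ∀ a, P (ln e a) ↔ p a = true) :
    {ℓ | P ℓ}.ncard = (Finset.univ.filter (fun a => p a = true)).card := by
  rw [← Set.ncard_coe_finset, ← Set.ncard_image_of_injective _ (ln_inj e)]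
  congr 1
  ext ℓ
  obtain ⟨a, rfl⟩ := ln_surj e ℓ
  simp [(ln_inj e).eq_iff, h]

theorem ncard_S (e : V ≃ₗ[K] V) (S : Set (PGPoint K)) : S.ncard = size (pmask e S) := by
  unfold size
  rw [countP_card, ← Set.ncard_coe_finset, ← Set.ncard_image_of_injective _ (pt_inj e)]
  congr 1
  ext x
  obtain ⟨k, rfl⟩ := pt_surj e x
  simp [(pt_inj e).eq_iff, pmask_bit]

theorem good (e : V ≃ₗ[K] V) (S : Set (PGPoint K)) (hS : IsTwoSemiarc S) : Good (pmask e S) := by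
  intro j hj hb
  have h1 := hS.2 _ ((pmask_bit e S ⟨j, hj⟩).1 hb)
  rw [ncard_lines e _ (fun a => (mask a &&& pmask e S) == 2 ^ j)
    (fun a => by rw [tangent_iff, beq_iff_eq]), ← countP_card] at h1
  rw [tcount_eq _ ⟨j, hj⟩, Lm_eq, List.countP_map]
  exact h1

/-! ### Noncollinear triple -/

theorem line_unique (x z : V) (h : LinearIndependent K ![x, z]) (ℓ : PGLine K) (hx : x ∈ ℓ.1)
    (hz : z ∈ ℓ.1) : ℓ.1 = Submodule.span K {x, z} := by
  symm
  apply Submodule.eq_of_le_of_finrank_eq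
  · rw [Submodule.span_le]
    rintro y (rfl | rfl)
    · exact hx
    · exact hz
  · rw [ℓ.2]
    have := finrank_span_eq_card h
    rw [Matrix.range_cons_cons_empty] at this
    simpa using this

theorem exists_basis (S : Set (PGPoint K)) (hS : IsTwoSemiarc S) :
    ∃ b : Module.Basis (Fin 3) K V, ∀ i, ∃ p ∈ S, ∃ h, p = Projectivization.mk K (b i) h := by
  obtain ⟨P, hP⟩ := hS.1
  have h2 := hS.2 P hP
  have hfin : ∀ T : Set (PGLine K), T.Finite := by
    intro T
    have : Finite (PGLine K) := Finite.of_surjective _ (ln_surj (LinearEquiv.refl K V))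
    exact Set.toFinite T
  have h6 : {ℓ : PGLine K | PGMem P ℓ}.ncard = 6 := by
    obtain ⟨j, rfl⟩ := pt_surj (LinearEquiv.refl K V) P
    rw [ncard_lines (LinearEquiv.refl K V) _ (fun a => inc a j) (fun a => mem_iff _ _ _)]
    exact lines_thru j
  have hlt : 1 < ({ℓ : PGLine K | PGMem P ℓ} \ {ℓ | PGTangent S ℓ P}).ncard := by
    have := Set.le_ncard_sdiff {ℓ | PGTangent S ℓ P} {ℓ : PGLine K | PGMem P ℓ} (hfin _)
    omega
  rw [Set.one_lt_ncard (hfin _)] at hlt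
  obtain ⟨a, ⟨ha, hta⟩, b, ⟨hb, htb⟩, hab⟩ := hlt
  have key : ∀ ℓ : PGLine K, PGMem P ℓ → ¬ PGTangent S ℓ P → ∃ Q ∈ S, PGMem Q ℓ ∧ Q ≠ P := by
    intro ℓ hl ht
    by_contra hc
    push Not at hc
    apply ht
    unfold PGTangent
    ext Q
    constructor
    · rintro ⟨h1, h2⟩
      exact hc Q h1 h2
    · rintro rfl
      exact ⟨hP, hl⟩
  obtain ⟨Q, hQ, hQa, hQP⟩ := key a ha hta
  obtain ⟨R, hR, hRb, hRP⟩ := key b hb htb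
  induction P using Projectivization.ind with
  | h x hx =>
  induction Q using Projectivization.ind with
  | h y hy =>
  induction R using Projectivization.ind with
  | h z hz =>
  simp only [Set.mem_ofPred_eq, mem_mk] at ha hb hQa hRb
  have ind : ∀ u w : V, ∀ hu hw, Projectivization.mk K u hu ≠ Projectivization.mk K w hw →
      LinearIndependent K ![u, w] := by
    intro u w hu hw h
    rw [LinearIndependent.pair_iff' hu]
    intro c hc
    apply h
    symm
    rw [Projectivization.mk_eq_mk_iff']
    exact ⟨c, hc⟩
  have hyx := ind y x hy hx hQP
  have hzx := ind z x hz hx hRP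
  have hz' : z ∉ Submodule.span K (Set.range ![y, x]) := by
    intro hmem
    have : z ∈ a.1 := by
      rw [line_unique y x hyx a hQa ha]
      rwa [Matrix.range_cons_cons_empty] at hmem
    apply hab
    apply Subtype.ext
    rw [line_unique z x hzx a this ha, line_unique z x hzx b hRb hb]
  have hli : LinearIndependent K ![z, y, x] := by
    exact linearIndependent_finCons.2 ⟨hyx, hz'⟩
  refine ⟨basisOfLinearIndependentOfCardEqFinrank hli (by simp), ?_⟩
  intro i
  rw [coe_basisOfLinearIndependentOfCardEqFinrank]
  fin_cases i
  · exact ⟨_, hR, hz, rfl⟩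
  · exact ⟨_, hQ, hy, rfl⟩
  · exact ⟨_, hP, hx, rfl⟩

theorem sub_of_list (M : ℕ) (I : ℕ) (hI : I < 2 ^ 31)
    (h : ∀ k : Fin 31, I.testBit k.1 = true → M.testBit k.1 = true) : Sub I M := by
  intro k hk
  by_cases hk' : k < 31
  · exact h ⟨k, hk'⟩ hk
  · rw [Nat.testBit_lt_two_pow] at hk
    · simp at hk
    · exact lt_of_lt_of_le hI (Nat.pow_le_pow_right (by norm_num) (by omega))

theorem I2_bits : ∀ k : Fin 31, I2.testBit k.1 = true →
    vec k = Pi.single 0 1 ∨ vec k = Pi.single 1 1 ∨ vec k = Pi.single 2 1 := by decide +kernel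

theorem I1_bits : ∀ k : Fin 31, I1.testBit k.1 = true →
    I2.testBit k.1 = true ∨ vec k = fun _ => 1 := by decide +kernel

theorem U2_bits : ∀ k : Fin 31, U2.testBit k.1 = true ∨
    (vec k 0 ≠ 0 ∧ vec k 1 ≠ 0 ∧ vec k 2 ≠ 0) := by decide +kernel

theorem base_bits (S : Set (PGPoint K)) (b : Module.Basis (Fin 3) K V)
    (hb : ∀ i, ∃ p ∈ S, ∃ h, p = Projectivization.mk K (b i) h) (k : Fin 31)
    (hk : I2.testBit k.1 = true) : (pmask b.equivFun.symm S).testBit k.1 = true := by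
  rw [pmask_bit]
  have : ∃ i, vec k = Pi.single i 1 := by
    rcases I2_bits k hk with h | h | h
    · exact ⟨_, h⟩
    · exact ⟨_, h⟩
    · exact ⟨_, h⟩
  obtain ⟨i, hi⟩ := this
  obtain ⟨p, hp, h, rfl⟩ := hb i
  rw [mk_eq_pt b.equivFun.symm (b i) h k 1] at hp
  · exact hp
  · rw [hi, one_smul, LinearEquiv.symm_symm]
    ext j
    rw [Module.Basis.equivFun_self]
    simp [Pi.single_apply, eq_comm]

theorem main (S : Set (PGPoint K)) (hS : IsTwoSemiarc S) : ∃ e, okSize (pmask e S) = true := by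
  obtain ⟨b, hb⟩ := exists_basis S hS
  by_cases hT : ∃ k : Fin 31, pt b.equivFun.symm k ∈ S ∧ vec k 0 ≠ 0 ∧ vec k 1 ≠ 0 ∧ vec k 2 ≠ 0
  · obtain ⟨k, hk, hk0, hk1, hk2⟩ := hT
    have hne : ∀ i, vec k i ≠ 0 := by
      intro i
      fin_cases i
      · exact hk0
      · exact hk1
      · exact hk2
    let b' := b.unitsSMul (fun i => Units.mk0 (vec k i) (hne i))
    have hb' : ∀ i, b' i = vec k i • b i := by
      intro i
      rw [Module.Basis.unitsSMul_apply]
      rfl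
    have hb2 : ∀ i, ∃ p ∈ S, ∃ h, p = Projectivization.mk K (b' i) h := by
      intro i
      obtain ⟨p, hp, h, rfl⟩ := hb i
      refine ⟨_, hp, b'.ne_zero i, ?_⟩
      symm
      rw [Projectivization.mk_eq_mk_iff']
      exact ⟨vec k i, (hb' i).symm⟩
    refine ⟨b'.equivFun.symm, search_sound (good _ S hS) order1 I1 (2 ^ 31 - 1) ?_ ?_ search1⟩
    · apply sub_of_list _ _ (by decide +kernel)
      intro l hl
      rcases I1_bits l hl with h | h
      · exact base_bits S b' hb2 l h
      · rw [pmask_bit]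
        have : pt b'.equivFun.symm l = pt b.equivFun.symm k := by
          have e1 : b'.equivFun.symm (vec l) = b.equivFun.symm (vec k) := by
            rw [Module.Basis.equivFun_symm_apply, Module.Basis.equivFun_symm_apply, h]
            simp [hb']
          unfold pt
          simp only [e1]
        rw [this]
        exact hk
    · intro l hl
      rw [Nat.testBit_two_pow_sub_one, decide_eq_true_iff]
      by_contra hc
      rw [pmask_bit_ge _ _ _ (by omega)] at hl
      simp at hl
  · refine ⟨b.equivFun.symm, search_sound (good _ S hS) order2 I2 U2 ?_ ?_ search2⟩
    · exact sub_of_list _ _ (by decide +kernel) (base_bits S b hb)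
    · intro l hl
      by_cases hl' : l < 31
      · rcases U2_bits ⟨l, hl'⟩ with h | h
        · exact h
        · exact absurd ⟨⟨l, hl'⟩, (pmask_bit _ S ⟨l, hl'⟩).1 hl, h⟩ hT
      · rw [pmask_bit_ge _ _ _ (by omega)] at hl
        simp at hl

end TwoSemiarcAux

/-- Every 2-semiarc in `PG(2,5)` has size 5, 6 or 9. -/
theorem two_semiarc_PG2_5_sizes (S : Set (PGPoint (ZMod 5))) (hS : IsTwoSemiarc S) :
    S.ncard ∈ ({5, 6, 9} : Set ℕ) := by
  obtain ⟨e, he⟩ := TwoSemiarcAux.main S hS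
  rw [TwoSemiarcAux.ncard_S e S]
  simp only [TwoSemiarcAux.okSize, Bool.or_eq_true, beq_iff_eq] at he
  simp only [Set.mem_insert_iff, Set.mem_singleton_iff]
  tauto
end
end

section
/- Let S be a 2-semiarc of size 6 in PG(2,5). Then S is the union of two trisecants: there exist two distinct lines ℓ₁ and ℓ₂ such that |S ∩ ℓ₁| = 3, |S ∩ ℓ₂| = 3, and S ⊆ ℓ₁ ∪ ℓ₂. -/
noncomputable section

open Classical in
theorem aux_line {F : Type*} [Field F] (p : PGPoint F) (v : Fin 3 → F) (hv : v ∉ p.submodule) :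
    ∃ ℓ : PGLine F, (p.submodule ≤ ℓ.1 ∧ v ∈ ℓ.1) ∧
      ∀ m : PGLine F, p.submodule ≤ m.1 → v ∈ m.1 → m = ℓ := by
  have h1 : Module.finrank F p.submodule = 1 := p.finrank_submodule
  have hv0 : v ≠ 0 := fun h => hv (h ▸ p.submodule.zero_mem)
  have h2 : Module.finrank F (Submodule.span F {v}) = 1 := finrank_span_singleton hv0
  have hinf : p.submodule ⊓ Submodule.span F {v} = ⊥ := by
    rw [eq_bot_iff]
    rintro x ⟨hx, hx'⟩
    obtain ⟨a, rfl⟩ := Submodule.mem_span_singleton.1 hx'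
    by_cases ha : a = 0
    · simp [ha]
    · exact absurd ((Submodule.smul_mem_iff _ ha).1 hx) hv
  have h3 := Submodule.finrank_sup_add_finrank_inf_eq p.submodule (Submodule.span F {v})
  rw [hinf, finrank_bot, h1, h2] at h3
  refine ⟨⟨p.submodule ⊔ Submodule.span F {v}, by omega⟩, ⟨le_sup_left, ?_⟩, ?_⟩
  · exact (le_sup_right : _ ≤ p.submodule ⊔ Submodule.span F {v}) (Submodule.mem_span_singleton_self v)
  · intro m hm hvm
    apply Subtype.ext
    symm
    apply Submodule.eq_of_le_of_finrank_eq
    · exact sup_le hm (by simpa using hvm)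
    · rw [m.2]; dsimp only; omega

instance auxFin : Finite (PGLine (ZMod 5)) := by
  have : Finite (Submodule (ZMod 5) (Fin 3 → ZMod 5)) :=
    Finite.of_injective (fun W => (W : Set (Fin 3 → ZMod 5))) SetLike.coe_injective
  infer_instance

instance auxFintype : Fintype (PGLine (ZMod 5)) := Fintype.ofFinite _

open Classical in
theorem aux_count (p : PGPoint (ZMod 5)) :
    (Finset.univ.filter (fun ℓ : PGLine (ZMod 5) => PGMem p ℓ)).card = 6 := by
  choose f hf hu using aux_line p
  let V : Finset (Fin 3 → ZMod 5) := Finset.univ.filter (fun v => v ∉ p.submodule)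
  have hcard : ∀ W : Submodule (ZMod 5) (Fin 3 → ZMod 5),
      (Finset.univ.filter (fun v => v ∈ W)).card = 5 ^ Module.finrank (ZMod 5) W := by
    intro W
    have := Module.card_eq_pow_finrank (K := ZMod 5) (V := W)
    rw [ZMod.card] at this
    rw [← this, Fintype.card_subtype]
  have hp := hcard p.submodule
  rw [p.finrank_submodule] at hp
  have hV : V.card = 120 := by
    have := Finset.card_filter_add_card_filter_not (s := (Finset.univ : Finset (Fin 3 → ZMod 5)))
      (fun v => v ∈ p.submodule)
    rw [hp, Finset.card_univ, Fintype.card_fun, ZMod.card, Fintype.card_fin] at this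
    change _ + V.card = _ at this
    omega
  let L := Finset.univ.filter (fun ℓ : PGLine (ZMod 5) => PGMem p ℓ)
  let g : (Fin 3 → ZMod 5) → Option (PGLine (ZMod 5)) := fun v =>
    if h : v ∉ p.submodule then some (f v h) else none
  have hmap : ∀ v ∈ V, g v ∈ L.image some := by
    intro v hv
    have hv' : v ∉ p.submodule := by simpa [V] using hv
    simp only [g, dif_pos hv', Finset.mem_image]
    exact ⟨_, Finset.mem_filter.2 ⟨Finset.mem_univ _, (hf v hv').1⟩, rfl⟩
  have hs := Finset.card_eq_sum_card_fiberwise hmap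
  rw [Finset.sum_image (by simp)] at hs
  have hfib : ∀ ℓ ∈ L, (V.filter (fun v => g v = some ℓ)).card = 20 := by
    intro ℓ hℓ
    have hpl : p.submodule ≤ ℓ.1 := (Finset.mem_filter.1 hℓ).2
    have e : V.filter (fun v => g v = some ℓ) =
        (Finset.univ.filter (fun v => v ∈ ℓ.1)) \ (Finset.univ.filter (fun v => v ∈ p.submodule)) := by
      ext v
      simp only [V, Finset.mem_filter, Finset.mem_univ, true_and, Finset.mem_sdiff]
      constructor
      · rintro ⟨h, h'⟩
        simp only [g, dif_pos h, Option.some.injEq] at h'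
        exact ⟨h' ▸ (hf v h).2, h⟩
      · rintro ⟨h', h⟩
        refine ⟨h, ?_⟩
        simp only [g, dif_pos h, Option.some.injEq]
        exact (hu v h ℓ hpl h').symm
    rw [e, Finset.card_sdiff_of_subset, hcard, hp, ℓ.2]
    · norm_num
    intro v
    simpa using @hpl v
  rw [Finset.sum_congr rfl hfib, hV] at hs
  simp only [Finset.sum_const, smul_eq_mul] at hs
  change L.card = 6
  omega

theorem aux_join {F : Type*} [Field F] (p q : PGPoint F) (h : p ≠ q) :
    ∃ ℓ : PGLine F, (PGMem p ℓ ∧ PGMem q ℓ) ∧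
      ∀ m : PGLine F, PGMem p m → PGMem q m → m = ℓ := by
  have key : ∀ m : PGLine F, PGMem q m ↔ q.rep ∈ m.1 := by
    intro m
    rw [PGMem, Projectivization.submodule_eq]
    simp
  have hq : q.rep ∉ p.submodule := by
    intro hq
    apply h
    apply Projectivization.submodule_injective
    symm
    have := p.finrank_submodule
    apply Submodule.eq_of_le_of_finrank_eq
    · rw [Projectivization.submodule_eq q]; simpa using hq
    · rw [p.finrank_submodule, q.finrank_submodule]
  obtain ⟨ℓ, ⟨h1, h2⟩, h3⟩ := aux_line p _ hq
  exact ⟨ℓ, ⟨h1, (key _).2 h2⟩, fun m a b => h3 m a ((key _).1 b)⟩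

open Classical in
theorem aux_tri (S : Finset (PGPoint (ZMod 5))) (hc : S.card = 6)
    (p : PGPoint (ZMod 5)) (hp : p ∈ S)
    (ht : {ℓ : PGLine (ZMod 5) | PGTangent (S : Set (PGPoint (ZMod 5))) ℓ p}.ncard = 2) :
    ∃ ℓ : PGLine (ZMod 5), (PGMem p ℓ ∧ (S.filter (fun x => PGMem x ℓ)).card = 3) ∧
      ∀ m : PGLine (ZMod 5), PGMem p m → (S.filter (fun x => PGMem x m)).card = 3 → m = ℓ := by
  let L := Finset.univ.filter (fun ℓ : PGLine (ZMod 5) => PGMem p ℓ)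
  have hL : L.card = 6 := aux_count p
  let c : PGLine (ZMod 5) → ℕ := fun ℓ => ((S.erase p).filter (fun x => PGMem x ℓ)).card
  have hcc : ∀ ℓ ∈ L, (S.filter (fun x => PGMem x ℓ)).card = c ℓ + 1 := by
    intro ℓ hℓ
    have hpl : PGMem p ℓ := by simpa [L] using hℓ
    simp only [c]
    rw [Finset.filter_erase, Finset.card_erase_add_one]
    simp [hp, hpl]
  have hsum : ∑ ℓ ∈ L, c ℓ = 5 := by
    simp only [c, Finset.card_filter]
    rw [Finset.sum_comm]
    have : ∀ q ∈ S.erase p, ∑ ℓ ∈ L, (if PGMem q ℓ then 1 else 0) = 1 := by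
      intro q hq
      obtain ⟨ℓ, ⟨h1, h2⟩, h3⟩ := aux_join p q (Finset.ne_of_mem_erase hq).symm
      rw [← Finset.card_filter, Finset.card_eq_one]
      refine ⟨ℓ, ?_⟩
      ext m
      simp only [L, Finset.mem_filter, Finset.mem_univ, true_and, Finset.mem_singleton]
      exact ⟨fun h => h3 m h.1 h.2, fun h => h ▸ ⟨h1, h2⟩⟩
    rw [Finset.sum_congr rfl this, Finset.sum_const, Finset.card_erase_of_mem hp, hc]
    rfl
  have htan : (L.filter (fun ℓ => c ℓ = 0)).card = 2 := by
    rw [← ht, ← Set.ncard_coe_finset]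
    congr 1
    ext ℓ
    simp only [L, c, Finset.coe_filter, Finset.mem_filter, Finset.mem_univ, true_and,
      Set.mem_ofPred_eq, PGTangent, Finset.card_eq_zero, Finset.filter_eq_empty_iff,
      Finset.mem_erase, Set.ext_iff, Set.mem_inter_iff, Finset.mem_coe, Set.mem_singleton_iff]
    constructor
    · rintro ⟨h1, h2⟩ x
      constructor
      · rintro ⟨a, b⟩
        by_contra hx
        exact h2 ⟨hx, a⟩ b
      · rintro rfl
        exact ⟨hp, h1⟩
    · intro h
      refine ⟨((h p).2 rfl).2, ?_⟩
      rintro x ⟨a, b⟩ d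
      exact a ((h x).1 ⟨b, d⟩)
  have hs1 : ∑ ℓ ∈ L, (c ℓ - 1) = 1 := by
    have e : ∑ ℓ ∈ L, (c ℓ - 1) + L.card = ∑ ℓ ∈ L, c ℓ + (L.filter (fun ℓ => c ℓ = 0)).card := by
      rw [Finset.card_filter (fun ℓ => c ℓ = 0) L, Finset.card_eq_sum_ones L, ← Finset.sum_add_distrib,
        ← Finset.sum_add_distrib]
      apply Finset.sum_congr rfl
      intro ℓ _
      split_ifs <;> omega
    omega
  have hex : ∃ ℓ ∈ L, c ℓ - 1 ≠ 0 := by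
    apply Finset.exists_ne_zero_of_sum_ne_zero
    omega
  obtain ⟨ℓ, hℓ, hne⟩ := hex
  have hsp := Finset.add_sum_erase L (fun ℓ => c ℓ - 1) hℓ
  rw [hs1] at hsp
  refine ⟨ℓ, ⟨by simpa [L] using hℓ, ?_⟩, ?_⟩
  · rw [hcc ℓ hℓ]; omega
  · intro m hm hm3
    have hmL : m ∈ L := by simpa [L] using hm
    by_contra hmne
    have hz : ∑ ℓ ∈ L.erase ℓ, (c ℓ - 1) = 0 := by omega
    have := Finset.sum_eq_zero_iff.1 hz m (Finset.mem_erase.2 ⟨hmne, hmL⟩)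
    have := hcc m hmL
    omega

/-- Every 2-semiarc of size 6 in `PG(2,5)` is the union of two trisecants. -/
theorem two_semiarc_PG2_5_size_six (S : Set (PGPoint (ZMod 5)))
    (hS : IsTwoSemiarc S) (hcard : S.ncard = 6) :
    ∃ ℓ₁ ℓ₂ : PGLine (ZMod 5), ℓ₁ ≠ ℓ₂ ∧
      (S ∩ {x | PGMem x ℓ₁}).ncard = 3 ∧ (S ∩ {x | PGMem x ℓ₂}).ncard = 3 ∧
      S ⊆ {x | PGMem x ℓ₁} ∪ {x | PGMem x ℓ₂} := by
  classical
  have hfin : S.Finite := Set.finite_of_ncard_ne_zero (by omega)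
  obtain ⟨T, rfl⟩ := hfin.exists_finset_coe
  rw [Set.ncard_coe_finset] at hcard
  obtain ⟨⟨p, hp⟩, h2⟩ := hS
  have tri := fun q (hq : q ∈ T) => aux_tri T hcard q hq (h2 q (by simpa using hq))
  have hn : ∀ ℓ : PGLine (ZMod 5), ((T : Set (PGPoint (ZMod 5))) ∩ {x | PGMem x ℓ}).ncard =
      (T.filter (fun x => PGMem x ℓ)).card := by
    intro ℓ
    rw [← Set.ncard_coe_finset]
    congr 1
    ext x
    simp
  obtain ⟨l, ⟨hpl, hl⟩, -⟩ := tri p (by simpa using hp)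
  have hq : ∃ q ∈ T, ¬ PGMem q l := by
    by_contra! h
    rw [Finset.filter_true_of_mem h] at hl
    omega
  obtain ⟨q, hqT, hql⟩ := hq
  obtain ⟨m, ⟨hqm, hm⟩, -⟩ := tri q hqT
  have hlm : l ≠ m := fun h => hql (h ▸ hqm)
  refine ⟨l, m, hlm, by rw [hn, hl], by rw [hn, hm], ?_⟩
  have hdis : Disjoint (T.filter (fun x => PGMem x l)) (T.filter (fun x => PGMem x m)) := by
    rw [Finset.disjoint_left]
    intro r hr hr'
    rw [Finset.mem_filter] at hr hr'
    obtain ⟨k, -, hk⟩ := tri r hr.1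
    exact hlm ((hk l hr.2 hl).trans (hk m hr'.2 hm).symm)
  have hcu := Finset.card_union_of_disjoint hdis
  rw [hl, hm, ← Finset.filter_or] at hcu
  have hall := Finset.eq_of_subset_of_card_le
    (Finset.filter_subset (fun x => PGMem x l ∨ PGMem x m) T) (by omega)
  intro x hx
  have hx' : x ∈ T := by simpa using hx
  rw [← hall, Finset.mem_filter] at hx'
  exact hx'.2
end
end

section
/- Let S be a 2-semiarc in PG(2,7). Then S has no 6-secants; in fact every line of PG(2,7) meets S in at most 5 points. -/
noncomputable section

instance : Fact (Nat.Prime 7) := ⟨by norm_num⟩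

/-- The combinatorial core: a counting argument in any projective plane of order 7. -/
theorem semiarc_core {P L : Type*} [Fintype P] [Fintype L] [DecidableEq P] [DecidableEq L]
    (I : P → L → Prop) [∀ p l, Decidable (I p l)]
    (hline : ∀ p q : P, p ≠ q → ∃ m, I p m ∧ I q m)
    (hmeet : ∀ l m : L, l ≠ m → ∃ p, I p l ∧ I p m)
    (huniq : ∀ (p q : P) (l m : L), I p l → I q l → I p m → I q m → p = q ∨ l = m)
    (hpts : ∀ l : L, (Finset.univ.filter (fun p => I p l)).card = 8)
    (hlns : ∀ p : P, (Finset.univ.filter (fun l => I p l)).card = 8)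
    (S : Finset P)
    (hS : ∀ p ∈ S,
      (Finset.univ.filter (fun l => I p l ∧ ∀ x ∈ S, I x l → x = p)).card = 2)
    (l : L) : (S.filter (fun p => I p l)).card ≤ 5 := by
  by_contra hcon
  push Not at hcon
  set T := S.filter (fun p => I p l) with hT
  set A := S.filter (fun p => ¬ I p l) with hA
  set C := (Finset.univ.filter (fun p => I p l)).filter (fun p => p ∉ S) with hC
  have memT : ∀ x, x ∈ T ↔ x ∈ S ∧ I x l := by intro x; simp [hT]
  have memA : ∀ x, x ∈ A ↔ x ∈ S ∧ ¬ I x l := by intro x; simp [hA]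
  have memC : ∀ x, x ∈ C ↔ I x l ∧ x ∉ S := by intro x; simp [hC]
  have hTC : T.card + C.card = 8 := by
    rw [← hpts l, ← Finset.card_filter_add_card_filter_not (s := Finset.univ.filter (fun p => I p l))
      (fun p => p ∈ S)]
    congr 2
    ext x; simp [hT, and_comm]
  -- lines through a point of `l` other than `l`
  have hlns7 : ∀ p, I p l → ((Finset.univ.filter (fun m => I p m)).erase l).card = 7 := by
    intro p hp
    rw [Finset.card_erase_of_mem (by simpa using hp), hlns]
  -- two points of T
  have hTne : ∀ p ∈ T, ∃ q ∈ T, q ≠ p := by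
    intro p hp
    exact Finset.exists_mem_ne (by omega) p
  -- lines through `p ∈ T` meeting `A`
  let B : P → Finset L := fun p =>
    ((Finset.univ.filter (fun m => I p m)).erase l).filter (fun m => ∃ x ∈ A, I x m)
  have memB : ∀ p m, m ∈ B p ↔ (m ≠ l ∧ I p m) ∧ ∃ x ∈ A, I x m := by
    intro p m; simp [B]
  have hB : ∀ p ∈ T, (B p).card = 5 := by
    intro p hp
    have hp' := (memT p).1 hp
    have h1 := Finset.card_filter_add_card_filter_not
      (s := (Finset.univ.filter (fun m => I p m)).erase l) (fun m => ∃ x ∈ A, I x m)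
    rw [hlns7 p hp'.2] at h1
    have h2 : ((Finset.univ.filter (fun m => I p m)).erase l).filter (fun m => ¬ ∃ x ∈ A, I x m)
        = Finset.univ.filter (fun m => I p m ∧ ∀ x ∈ S, I x m → x = p) := by
      ext m
      simp only [Finset.mem_filter, Finset.mem_erase, Finset.mem_univ, true_and]
      constructor
      · rintro ⟨⟨hml, hpm⟩, hno⟩
        refine ⟨hpm, fun x hx hxm => ?_⟩
        by_cases hxl : I x l
        · exact (huniq x p m l hxm hpm hxl hp'.2).resolve_right hml
        · exact absurd ⟨x, (memA x).2 ⟨hx, hxl⟩, hxm⟩ hno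
      · rintro ⟨hpm, hall⟩
        refine ⟨⟨?_, hpm⟩, ?_⟩
        · rintro rfl
          obtain ⟨q, hq, hqp⟩ := hTne p hp
          exact hqp (hall q ((memT q).1 hq).1 ((memT q).1 hq).2)
        · rintro ⟨x, hx, hxm⟩
          have := hall x ((memA x).1 hx).1 hxm
          subst this
          exact ((memA x).1 hx).2 hp'.2
    rw [h2, hS p hp'.1] at h1
    change (B p).card + 2 = 7 at h1
    omega
  obtain ⟨p0, hp0⟩ : T.Nonempty := Finset.card_pos.1 (by omega)
  have hAne : A.Nonempty := by
    have : (B p0).Nonempty := Finset.card_pos.1 (by rw [hB p0 hp0]; omega)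
    obtain ⟨m, hm⟩ := this
    obtain ⟨-, x, hx, -⟩ := (memB p0 m).1 hm
    exact ⟨x, hx⟩
  -- tangents at points of `A` go through points of `C`
  have key : ∀ q ∈ A, 2 ≤ C.card ∧ ∀ x ∈ C, ∃ m, I q m ∧ I x m ∧ ∀ y ∈ S, I y m → y = q := by
    intro q hq
    have hq' := (memA q).1 hq
    have ht := hS q hq'.1
    set Tg := Finset.univ.filter (fun m => I q m ∧ ∀ x ∈ S, I x m → x = q) with hTg
    have memTg : ∀ m, m ∈ Tg ↔ I q m ∧ ∀ x ∈ S, I x m → x = q := by intro m; simp [hTg]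
    have hex : ∀ m, ∃ x, m ∈ Tg → I x m ∧ I x l := by
      intro m
      by_cases hm : m ∈ Tg
      · have hml : m ≠ l := by
          rintro rfl
          exact hq'.2 ((memTg _).1 hm).1
        obtain ⟨x, hx⟩ := hmeet m l hml
        exact ⟨x, fun _ => hx⟩
      · exact ⟨q, fun h => absurd h hm⟩
    choose f hf using hex
    have hinj : Set.InjOn f (Tg : Set L) := by
      intro m hm m' hm' hmm
      have hm1 := Finset.mem_coe.1 hm
      have hm1' := Finset.mem_coe.1 hm'
      have h1 := hf m hm1
      have h2 := hf m' hm1'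
      rw [← hmm] at h2
      refine (huniq (f m) q m m' h1.1 ((memTg _).1 hm1).1 h2.1 ((memTg _).1 hm1').1).resolve_left ?_
      intro h
      rw [h] at h1
      exact hq'.2 h1.2
    have hsub : Tg.image f ⊆ C := by
      intro x hx
      obtain ⟨m, hm, rfl⟩ := Finset.mem_image.1 hx
      have h1 := hf m hm
      refine (memC _).2 ⟨h1.2, fun hS' => ?_⟩
      have := ((memTg _).1 hm).2 _ hS' h1.1
      rw [this] at h1
      exact hq'.2 h1.2
    have hcard : (Tg.image f).card = 2 := by rw [Finset.card_image_of_injOn hinj, ht]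
    refine ⟨hcard ▸ Finset.card_le_card hsub, fun x hx => ?_⟩
    have heq := Finset.eq_of_subset_of_card_le hsub (by omega)
    rw [← heq] at hx
    obtain ⟨m, hm, rfl⟩ := Finset.mem_image.1 hx
    exact ⟨m, ((memTg _).1 hm).1, (hf m hm).1, ((memTg _).1 hm).2⟩
  obtain ⟨q0, hq0⟩ := hAne
  have hC2 := (key q0 hq0).1
  have hT6 : T.card = 6 := by omega
  have hCA : ∀ x ∈ C, ∀ q ∈ A, ∀ q' ∈ A, ∀ m, I x m → I q m → I q' m → q' = q := by
    intro x hx q hq q' hq' m hxm hqm hqm'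
    obtain ⟨m', h1, h2, h3⟩ := (key q hq).2 x hx
    rcases huniq x q m m' hxm hqm h2 h1 with h | h
    · subst h
      exact absurd ((memA _).1 hq).1 ((memC _).1 hx).2
    · subst h
      exact h3 q' ((memA _).1 hq').1 hqm'
  have hA7 : A.card ≤ 7 := by
    obtain ⟨x, hx⟩ : C.Nonempty := Finset.card_pos.1 (by omega)
    have hx' := (memC x).1 hx
    rw [← hlns7 x hx'.1]
    have hex : ∀ q, ∃ m, q ∈ A → I q m ∧ I x m := by
      intro q
      by_cases hq : q ∈ A
      · obtain ⟨m, h1, h2, -⟩ := (key q hq).2 x hx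
        exact ⟨m, fun _ => ⟨h1, h2⟩⟩
      · exact ⟨l, fun h => absurd h hq⟩
    choose f hf using hex
    refine Finset.card_le_card_of_injOn f ?_ ?_
    · intro q hq
      have hq1 := Finset.mem_coe.1 hq
      have h1 := hf q hq1
      simp only [Finset.coe_erase, Set.mem_sdiff, Finset.mem_coe, Finset.mem_filter,
        Finset.mem_univ, true_and, Set.mem_singleton_iff]
      refine ⟨h1.2, fun h => ?_⟩
      rw [h] at h1
      exact ((memA q).1 hq1).2 h1.1
    · intro q hq q' hq' h
      have h1 := hf q (Finset.mem_coe.1 hq)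
      have h2 := hf q' (Finset.mem_coe.1 hq')
      rw [← h] at h2
      exact (hCA x hx q hq q' hq' _ h1.2 h1.1 h2.1).symm
  -- counting on the pencil at a point of `T`
  let c : L → ℕ := fun m => (A.filter (fun x => I x m)).card
  have hcsum : ∀ p ∈ T, ∑ m ∈ B p, c m = A.card := by
    intro p hp
    have hp' := (memT p).1 hp
    have hdisj : ((B p : Finset L) : Set L).PairwiseDisjoint
        (fun m => A.filter (fun x => I x m)) := by
      intro m hm m' hm' hmm
      rw [Function.onFun, Finset.disjoint_left]
      intro x hx hx'
      obtain ⟨hxA, hxm⟩ := Finset.mem_filter.1 hx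
      have hxm' := (Finset.mem_filter.1 hx').2
      rcases huniq x p m m' hxm ((memB p m).1 hm).1.2 hxm' ((memB p m').1 hm').1.2 with h | h
      · subst h
        exact ((memA x).1 hxA).2 hp'.2
      · exact hmm h
    rw [← Finset.card_biUnion hdisj]
    congr 1
    ext x
    simp only [Finset.mem_biUnion, Finset.mem_filter]
    constructor
    · rintro ⟨m, -, h, -⟩
      exact h
    · intro hx
      have hx' := (memA x).1 hx
      have hpx : p ≠ x := by
        rintro rfl
        exact hx'.2 hp'.2
      obtain ⟨m, h1, h2⟩ := hline p x hpx
      refine ⟨m, (memB p m).2 ⟨⟨?_, h1⟩, x, hx, h2⟩, hx, h2⟩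
      rintro rfl
      exact hx'.2 h2
  have hcpos : ∀ p, ∀ m ∈ B p, 1 ≤ c m := by
    intro p m hm
    obtain ⟨-, x, hx, hxm⟩ := (memB p m).1 hm
    exact Finset.card_pos.2 ⟨x, Finset.mem_filter.2 ⟨hx, hxm⟩⟩
  have hc3 : ∀ p ∈ T, ∀ m ∈ B p, c m ≤ 3 := by
    intro p hp m hm
    have h1 := Finset.add_sum_erase (B p) c hm
    rw [hcsum p hp] at h1
    have h2 : ((B p).erase m).card • 1 ≤ ∑ x ∈ (B p).erase m, c x :=
      Finset.card_nsmul_le_sum _ _ _ (fun x hx => hcpos p x (Finset.mem_of_mem_erase hx))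
    rw [Finset.card_erase_of_mem hm, hB p hp] at h2
    simp only [smul_eq_mul] at h2
    omega
  have hA5 : 5 ≤ A.card := by
    have h2 : (B p0).card • 1 ≤ ∑ x ∈ B p0, c x :=
      Finset.card_nsmul_le_sum _ _ _ (fun x hx => hcpos p0 x hx)
    rw [hcsum p0 hp0, hB p0 hp0] at h2
    simpa using h2
  have hpen : ∀ p ∈ T, (∑ m ∈ B p, (c m * c m - c m)) + 15 ≤ 3 * A.card := by
    intro p hp
    have h1 : ∑ m ∈ B p, ((c m * c m - c m) + 3) ≤ ∑ m ∈ B p, 3 * c m := by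
      refine Finset.sum_le_sum (fun m hm => ?_)
      have h1 := hcpos p m hm
      have h3 := hc3 p hp m hm
      interval_cases c m <;> simp
    rw [Finset.sum_add_distrib, ← Finset.mul_sum, hcsum p hp, Finset.sum_const, hB p hp] at h1
    simpa using h1
  have hoff : A.offDiag ⊆
      T.biUnion (fun p => (B p).biUnion (fun m => (A.filter (fun x => I x m)).offDiag)) := by
    rintro ⟨x, y⟩ hxy
    obtain ⟨hx, hy, hne⟩ := Finset.mem_offDiag.1 hxy
    obtain ⟨m, hxm, hym⟩ := hline x y hne
    have hml : m ≠ l := by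
      rintro rfl
      exact ((memA x).1 hx).2 hxm
    obtain ⟨p, hpm, hpl⟩ := hmeet m l hml
    have hpS : p ∈ S := by
      by_contra hpS
      exact hne (hCA p ((memC p).2 ⟨hpl, hpS⟩) y hy x hx m hpm hym hxm)
    simp only [Finset.mem_biUnion, Finset.mem_offDiag, Finset.mem_filter]
    exact ⟨p, (memT p).2 ⟨hpS, hpl⟩, m, (memB p m).2 ⟨⟨hml, hpm⟩, x, hx, hxm⟩,
      ⟨hx, hxm⟩, ⟨hy, hym⟩, hne⟩
  have hfin : A.card * A.card - A.card ≤ 6 * (3 * A.card - 15) := by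
    rw [← Finset.offDiag_card, ← hT6, ← smul_eq_mul]
    refine (Finset.card_le_card hoff).trans (Finset.card_biUnion_le.trans ?_)
    refine Finset.sum_le_card_nsmul _ _ _ (fun p hp => ?_)
    refine Finset.card_biUnion_le.trans ?_
    simp only [Finset.offDiag_card]
    have := hpen p hp
    change (∑ m ∈ B p, (c m * c m - c m)) ≤ _
    omega
  generalize A.card = n at hfin hA5 hA7
  interval_cases n <;> simp at hfin

section plane

theorem pg_line (p q : PGPoint (ZMod 7)) (h : p ≠ q) : ∃ m : PGLine (ZMod 7), PGMem p m ∧ PGMem q m := by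
  refine ⟨⟨p.submodule ⊔ q.submodule, ?_⟩, le_sup_left, le_sup_right⟩
  have h1 := Submodule.finrank_sup_add_finrank_inf_eq p.submodule q.submodule
  rw [p.finrank_submodule, q.finrank_submodule] at h1
  have h2 : Module.finrank (ZMod 7) (p.submodule ⊓ q.submodule : Submodule (ZMod 7) (Fin 3 → (ZMod 7))) < 1 := by
    by_contra hc
    push Not at hc
    have e1 : p.submodule ⊓ q.submodule = p.submodule :=
      Submodule.eq_of_le_of_finrank_le inf_le_left (by rw [p.finrank_submodule]; exact hc)
    have e2 : p.submodule ⊓ q.submodule = q.submodule :=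
      Submodule.eq_of_le_of_finrank_le inf_le_right (by rw [q.finrank_submodule]; exact hc)
    exact h (Projectivization.submodule_injective (e1.symm.trans e2))
  omega

theorem pg_uniq (p q : PGPoint (ZMod 7)) (l m : PGLine (ZMod 7)) (h1 : PGMem p l) (h2 : PGMem q l)
    (h3 : PGMem p m) (h4 : PGMem q m) : p = q ∨ l = m := by
  by_cases h : p = q
  · exact Or.inl h
  right
  obtain ⟨n, -, -⟩ := pg_line p q h
  have h5 := Submodule.finrank_sup_add_finrank_inf_eq p.submodule q.submodule
  rw [p.finrank_submodule, q.finrank_submodule] at h5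
  have h6 : Module.finrank (ZMod 7) (p.submodule ⊓ q.submodule : Submodule (ZMod 7) (Fin 3 → (ZMod 7))) < 1 := by
    by_contra hc
    push Not at hc
    have e1 : p.submodule ⊓ q.submodule = p.submodule :=
      Submodule.eq_of_le_of_finrank_le inf_le_left (by rw [p.finrank_submodule]; exact hc)
    have e2 : p.submodule ⊓ q.submodule = q.submodule :=
      Submodule.eq_of_le_of_finrank_le inf_le_right (by rw [q.finrank_submodule]; exact hc)
    exact h (Projectivization.submodule_injective (e1.symm.trans e2))
  have e1 : p.submodule ⊔ q.submodule = l.1 :=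
    Submodule.eq_of_le_of_finrank_le (sup_le h1 h2) (by rw [l.2]; omega)
  have e2 : p.submodule ⊔ q.submodule = m.1 :=
    Submodule.eq_of_le_of_finrank_le (sup_le h3 h4) (by rw [m.2]; omega)
  exact Subtype.ext (e1.symm.trans e2)

theorem pg_meet (l m : PGLine (ZMod 7)) (h : l ≠ m) : ∃ p : PGPoint (ZMod 7), PGMem p l ∧ PGMem p m := by
  have h1 := Submodule.finrank_sup_add_finrank_inf_eq l.1 m.1
  rw [l.2, m.2] at h1
  have h2 : Module.finrank (ZMod 7) (l.1 ⊔ m.1 : Submodule (ZMod 7) (Fin 3 → (ZMod 7))) ≤ 3 := by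
    have := Submodule.finrank_le (l.1 ⊔ m.1)
    simpa using this
  have h3 : 0 < Module.finrank (ZMod 7) (l.1 ⊓ m.1 : Submodule (ZMod 7) (Fin 3 → (ZMod 7))) := by omega
  rw [Module.finrank_pos_iff_exists_ne_zero] at h3
  obtain ⟨⟨v, hv⟩, hv0⟩ := h3
  have hv0' : v ≠ 0 := fun h => hv0 (Subtype.ext h)
  refine ⟨Projectivization.mk (ZMod 7) v hv0', ?_, ?_⟩
  · simpa [PGMem, Projectivization.submodule_mk] using hv.1
  · simpa [PGMem, Projectivization.submodule_mk] using hv.2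

theorem pg_exists_point (l : PGLine (ZMod 7)) : ∃ p : PGPoint (ZMod 7), ¬ PGMem p l := by
  by_contra hc
  push Not at hc
  have : l.1 = ⊤ := by
    rw [eq_top_iff]
    intro v _
    by_cases hv : v = 0
    · rw [hv]; exact l.1.zero_mem
    · simpa [PGMem, Projectivization.submodule_mk] using hc (Projectivization.mk (ZMod 7) v hv)
  have h2 := l.2
  rw [this] at h2
  simp at h2

/-- The line with given nonzero coordinate vector. -/
theorem pg_dual (v : Fin 3 → (ZMod 7)) (hv : v ≠ 0) :
    ∃ l : PGLine (ZMod 7), ∀ (w : Fin 3 → (ZMod 7)) (hw : w ≠ 0),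
      PGMem (Projectivization.mk (ZMod 7) w hw) l ↔ v ⬝ᵥ w = 0 := by
  let f : (Fin 3 → (ZMod 7)) →ₗ[(ZMod 7)] (ZMod 7) := dotProductBilin (ZMod 7) (ZMod 7) v
  have hf : ∀ w, f w = v ⬝ᵥ w := fun w => rfl
  have hne : f ≠ 0 := by
    intro h
    apply hv
    ext i
    have := hf (Pi.single i 1)
    rw [h] at this
    simpa using this.symm
  have h1 := LinearMap.finrank_range_add_finrank_ker f
  rw [LinearMap.range_eq_top.2 (LinearMap.surjective hne)] at h1
  refine ⟨⟨LinearMap.ker f, ?_⟩, ?_⟩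
  · simp at h1
    omega
  · intro w hw
    simp [PGMem, Projectivization.submodule_mk, hf]

theorem pg_config : ∃ (p₁ p₂ p₃ : PGPoint (ZMod 7)) (l₁ l₂ l₃ : PGLine (ZMod 7)),
    ¬ PGMem p₁ l₂ ∧ ¬ PGMem p₁ l₃ ∧ ¬ PGMem p₂ l₁ ∧ PGMem p₂ l₂ ∧ PGMem p₂ l₃ ∧
      ¬ PGMem p₃ l₁ ∧ PGMem p₃ l₂ ∧ ¬ PGMem p₃ l₃ := by
  obtain ⟨l₁, h₁⟩ := pg_dual ![1, 1, 0] (by decide)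
  obtain ⟨l₂, h₂⟩ := pg_dual ![0, 0, 1] (by decide)
  obtain ⟨l₃, h₃⟩ := pg_dual ![0, 1, 0] (by decide)
  refine ⟨Projectivization.mk (ZMod 7) ![0, 1, 1] (by decide),
    Projectivization.mk (ZMod 7) ![1, 0, 0] (by decide),
    Projectivization.mk (ZMod 7) ![0, 1, 0] (by decide), l₁, l₂, l₃, ?_⟩
  simp only [h₁, h₂, h₃]
  decide

theorem pg_exists_line (p : PGPoint (ZMod 7)) : ∃ l : PGLine (ZMod 7), ¬ PGMem p l := by
  induction p using Projectivization.ind with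
  | h w hw =>
    by_contra hc
    push Not at hc
    apply hw
    ext i
    obtain ⟨l, hl⟩ := pg_dual (Pi.single i 1) (by simp)
    have := (hl w hw).1 (hc l)
    simpa using this

/-- Incidence of points and lines as a membership relation. -/
@[reducible] def pgMembership : Membership (PGPoint (ZMod 7)) (PGLine (ZMod 7)) := ⟨fun l p => PGMem p l⟩

attribute [local instance] pgMembership

/-- The projective plane structure on `PG(2,7)`. -/
@[reducible] def pgPlane : Configuration.ProjectivePlane (PGPoint (ZMod 7)) (PGLine (ZMod 7)) where
  exists_point := pg_exists_point
  exists_line := pg_exists_line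
  eq_or_eq := fun h1 h2 h3 h4 => pg_uniq _ _ _ _ h1 h2 h3 h4
  mkPoint := fun h => Classical.choose (pg_meet _ _ h)
  mkPoint_ax := fun h => Classical.choose_spec (pg_meet _ _ h)
  mkLine := fun h => Classical.choose (pg_line _ _ h)
  mkLine_ax := fun h => Classical.choose_spec (pg_line _ _ h)
  exists_config := pg_config

attribute [local instance] pgPlane

theorem pg_finite_points : Finite (PGPoint (ZMod 7)) := inferInstance

theorem pg_finite_lines : Finite (PGLine (ZMod 7)) := inferInstance

theorem pg_order : Configuration.ProjectivePlane.order (PGPoint (ZMod 7)) (PGLine (ZMod 7)) = 7 := by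
  have := Fintype.ofFinite (PGPoint (ZMod 7))
  have h1 := Configuration.ProjectivePlane.card_points (PGPoint (ZMod 7)) (PGLine (ZMod 7))
  rw [← Nat.card_eq_fintype_card,
    Projectivization.card_of_finrank (ZMod 7) (Fin 3 → (ZMod 7)) (n := 3) (by simp)] at h1
  simp [Finset.sum_range_succ] at h1
  nlinarith

theorem pg_lines_card (p : PGPoint (ZMod 7)) : Nat.card {l : PGLine (ZMod 7) // PGMem p l} = 8 := by
  have := Configuration.ProjectivePlane.lineCount_eq (PGLine (ZMod 7)) p
  rw [pg_order] at this
  exact this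

theorem pg_points_card (l : PGLine (ZMod 7)) : Nat.card {p : PGPoint (ZMod 7) // PGMem p l} = 8 := by
  have := Configuration.ProjectivePlane.pointCount_eq (PGPoint (ZMod 7)) l
  rw [pg_order] at this
  exact this

end plane

open Classical in
theorem semiarc_le_five (S : Set (PGPoint (ZMod 7))) (hS : IsTwoSemiarc S)
    (l : PGLine (ZMod 7)) : (S ∩ {x | PGMem x l}).ncard ≤ 5 := by
  have := Fintype.ofFinite (PGPoint (ZMod 7))
  have := Fintype.ofFinite (PGLine (ZMod 7))
  have h := semiarc_core (P := PGPoint (ZMod 7)) (L := PGLine (ZMod 7)) PGMem pg_line pg_meet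
    pg_uniq
    (fun l => by rw [← Fintype.card_subtype, ← Nat.card_eq_fintype_card]; exact pg_points_card l)
    (fun p => by rw [← Fintype.card_subtype, ← Nat.card_eq_fintype_card]; exact pg_lines_card p)
    S.toFinset ?_ l
  · rw [← Set.ncard_coe_finset] at h
    convert h using 2
    ext x; simp
  · intro p hp
    have hp' : p ∈ S := by simpa using hp
    rw [← hS.2 p hp', ← Set.ncard_coe_finset]
    congr 1
    ext m
    simp only [Finset.coe_filter, Finset.mem_univ, true_and, Set.mem_setOf_eq, Set.mem_toFinset,
      PGTangent, Set.ext_iff, Set.mem_inter_iff, Set.mem_singleton_iff]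
    constructor
    · rintro ⟨h1, h2⟩ x
      exact ⟨fun hx => h2 x hx.1 hx.2, fun hx => hx ▸ ⟨hp', h1⟩⟩
    · intro hx
      exact ⟨((hx p).2 rfl).2, fun x h1 h2 => (hx x).1 ⟨h1, h2⟩⟩

/-- A 2-semiarc in `PG(2,7)` has no 6-secants; in fact every line meets it in at most
5 points. -/
theorem two_semiarc_PG2_7_no_six_secant (S : Set (PGPoint (ZMod 7)))
    (hS : IsTwoSemiarc S) :
    (¬ ∃ ℓ : PGLine (ZMod 7), (S ∩ {x | PGMem x ℓ}).ncard = 6) ∧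
      ∀ ℓ : PGLine (ZMod 7), (S ∩ {x | PGMem x ℓ}).ncard ≤ 5 := by 
  refine ⟨?_, semiarc_le_five S hS⟩
  rintro ⟨l, hl⟩
  have := semiarc_le_five S hS l
  omega
end
end

section
/- Let S be a 2-semiarc in PG(2,7), and let ℓ₁ and ℓ₂ be two distinct 5-secants of S (lines each meeting S in exactly 5 points) such that the common point of ℓ₁ and ℓ₂ does not belong to S. Then S is the union of these two 5-secants, i.e. S ⊆ ℓ₁ ∪ ℓ₂ (so S = (S ∩ ℓ₁) ∪ (S ∩ ℓ₂) and |S| = 10). -/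
noncomputable section

theorem sa_mem_iff {F : Type*} [Field F] (p : PGPoint F) (l : PGLine F) :
    PGMem p l ↔ p.rep ∈ l.1 := by
  unfold PGMem
  rw [Projectivization.submodule_eq, Submodule.span_singleton_le_iff_mem]

theorem sa_indep {F : Type*} [Field F] {p q : PGPoint F} (h : p ≠ q) :
    LinearIndependent F ![p.rep, q.rep] := by
  exact Projectivization.linearIndependent_pair_iff_ne.2 h

theorem sa_span {F : Type*} [Field F] {p q : PGPoint F} (h : p ≠ q) :
    Module.finrank F (Submodule.span F {p.rep, q.rep}) = 2 := by
  have := finrank_span_eq_card (sa_indep h)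
  rw [Matrix.range_cons_cons_empty] at this
  simpa using this

theorem sa_join {F : Type*} [Field F] {p q : PGPoint F} (h : p ≠ q) :
    ∃ l : PGLine F, PGMem p l ∧ PGMem q l := by
  refine ⟨⟨_, sa_span h⟩, ?_, ?_⟩ <;> rw [sa_mem_iff] <;> apply Submodule.subset_span <;> simp

theorem sa_eq_span {F : Type*} [Field F] {p q : PGPoint F} (h : p ≠ q) {l : PGLine F}
    (hp : PGMem p l) (hq : PGMem q l) : Submodule.span F {p.rep, q.rep} = l.1 := by
  rw [sa_mem_iff] at hp hq
  apply Submodule.eq_of_le_of_finrank_eq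
  · rw [Submodule.span_le]
    rintro x (rfl | rfl) <;> assumption
  · rw [sa_span h, l.2]

theorem sa_unique {F : Type*} [Field F] {p q : PGPoint F} {l m : PGLine F} (h : p ≠ q)
    (hp : PGMem p l) (hq : PGMem q l) (hp' : PGMem p m) (hq' : PGMem q m) : l = m :=
  Subtype.ext ((sa_eq_span h hp hq).symm.trans (sa_eq_span h hp' hq'))

theorem sa_comb {F : Type*} [Field F] {p q r : PGPoint F} {l : PGLine F} (h : p ≠ q)
    (hp : PGMem p l) (hq : PGMem q l) (hr : PGMem r l) :
    ∃ s t : F, r.rep = s • p.rep + t • q.rep := by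
  rw [sa_mem_iff, ← sa_eq_span h hp hq, Submodule.mem_span_pair] at hr
  obtain ⟨s, t, e⟩ := hr
  exact ⟨s, t, e.symm⟩

theorem sa_meet {F : Type*} [Field F] (l m : PGLine F) : ∃ p, PGMem p l ∧ PGMem p m := by
  have h := Submodule.finrank_sup_add_finrank_inf_eq l.1 m.1
  have h' := Submodule.finrank_le (l.1 ⊔ m.1)
  rw [l.2, m.2] at h
  rw [Module.finrank_fin_fun] at h'
  have hb : l.1 ⊓ m.1 ≠ ⊥ := by
    intro e
    rw [e, finrank_bot] at h
    omega
  obtain ⟨v, hv, hv0⟩ := Submodule.exists_mem_ne_zero_of_ne_bot hb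
  refine ⟨Projectivization.mk F v hv0, ?_, ?_⟩ <;> unfold PGMem <;>
    rw [Projectivization.submodule_mk, Submodule.span_singleton_le_iff_mem]
  · exact hv.1
  · exact hv.2

theorem sa_card (l : PGLine (ZMod 7)) : {x | PGMem x l}.ncard = 8 := by
  have hr : {x | PGMem x l} =
      Set.range (Projectivization.map l.1.subtype l.1.injective_subtype) := by
    ext x
    simp only [Set.mem_ofPred_eq, Set.mem_range]
    constructor
    · intro hx
      rw [sa_mem_iff] at hx
      refine ⟨Projectivization.mk _ ⟨x.rep, hx⟩ ?_, ?_⟩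
      · intro e
        exact x.rep_nonzero (congrArg Subtype.val e)
      · rw [Projectivization.map_mk]
        exact x.mk_rep
    · rintro ⟨y, rfl⟩
      induction y using Projectivization.ind with
      | h v hv =>
        rw [Projectivization.map_mk]
        unfold PGMem
        rw [Projectivization.submodule_mk, Submodule.span_singleton_le_iff_mem]
        exact v.2
  rw [hr, ← Set.image_univ, Set.ncard_image_of_injective _ (Projectivization.map_injective _ l.1.injective_subtype), Set.ncard_univ,
    Projectivization.card_of_finrank_two _ _ l.2]
  simp

theorem sa_pair {F V : Type*} [Field F] [AddCommGroup V] [Module F V] {p q : Projectivization F V}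
    (h : p ≠ q) (s t : F) (e : s • p.rep + t • q.rep = 0) : s = 0 ∧ t = 0 :=
  LinearIndependent.pair_iff.1 (Projectivization.linearIndependent_pair_iff_ne.2 h) s t e

theorem sa_fano_vec {F V : Type*} [Field F] [AddCommGroup V] [Module F V]
    {a₁ a₂ b₁ b₂ o x z : V} {s t s' t' u v u' v' p q p' q' : F}
    (li : ∀ c d e : F, c • a₁ + d • a₂ + e • b₁ = 0 → c = 0 ∧ d = 0 ∧ e = 0)
    (ex : x = s • a₁ + t • b₁) (ex' : x = s' • a₂ + t' • b₂)
    (ez : z = u • a₁ + v • b₂) (ez' : z = u' • a₂ + v' • b₁)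
    (eo : o = p • a₁ + q • a₂) (eo' : o = p' • b₁ + q' • b₂) :
    (v * q') • x + (v * t') • o - (t' * q') • z = (2 * (v * q' * s)) • a₁ := by
  have e1 : s • a₁ + t • b₁ = s' • a₂ + t' • b₂ := by rw [← ex, ex']
  have e2 : u • a₁ + v • b₂ = u' • a₂ + v' • b₁ := by rw [← ez, ez']
  have e3 : p • a₁ + q • a₂ = p' • b₁ + q' • b₂ := by rw [← eo, eo']
  have f1 := li (v * s + t' * u) (-(v * s') - t' * u') (v * t - t' * v') (by
    linear_combination (norm := module) v • e1 + t' • e2)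
  have f2 := li (q' * s - t' * p) (-(q' * s') - t' * q) (q' * t + t' * p') (by
    linear_combination (norm := module) q' • e1 - t' • e3)
  obtain ⟨-, g1, g2⟩ := f1
  obtain ⟨g3, g4, -⟩ := f2
  have c1 : v * t' * p = v * q' * s := by linear_combination -v * g3
  have c2 : v * t' * q - t' * q' * u' = 0 := by linear_combination q' * g1 - v * g4
  have c3 : v * q' * t - t' * q' * v' = 0 := by linear_combination q' * g2
  have : (v * q') • x + (v * t') • o - (t' * q') • z = (v * q' * s + v * t' * p) • a₁
      + (v * t' * q - t' * q' * u') • a₂ + (v * q' * t - t' * q' * v') • b₁ := by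
    rw [ex, ez', eo]; module
  rw [this, c1, c2, c3]; module

/-- The Fano property: if the diagonal points of a quadrangle are collinear, then a vertex is on
that line. -/
theorem sa_fano {F : Type*} [Field F] (h2 : (2 : F) ≠ 0) {a₁ a₂ b₁ b₂ o x z : PGPoint F}
    {l₁ l₂ m₁ m₂ n₁ n₂ w : PGLine F} (ha : a₁ ≠ a₂) (hb : b₁ ≠ b₂)
    (hb1 : ¬ PGMem b₁ l₁)
    (ha₁ : PGMem a₁ l₁) (ha₂ : PGMem a₂ l₁) (ho₁ : PGMem o l₁)
    (hb₁ : PGMem b₁ l₂) (hb₂ : PGMem b₂ l₂) (ho₂ : PGMem o l₂) (hob : o ≠ b₁)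
    (h11 : PGMem a₁ m₁) (h12 : PGMem b₁ m₁) (h13 : PGMem x m₁)
    (h21 : PGMem a₂ m₂) (h22 : PGMem b₂ m₂) (h23 : PGMem x m₂) (hab2 : a₂ ≠ b₂)
    (h31 : PGMem a₁ n₁) (h32 : PGMem b₂ n₁) (h33 : PGMem z n₁) (hab1 : a₁ ≠ b₂)
    (h41 : PGMem a₂ n₂) (h42 : PGMem b₁ n₂) (h43 : PGMem z n₂)
    (hxa : x ≠ a₂) (hza : z ≠ a₁) (hxb : x ≠ b₁)
    (hx : PGMem x w) (hz : PGMem z w) (ho : PGMem o w) : PGMem a₁ w := by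
  have hab1' : a₁ ≠ b₁ := by rintro rfl; exact hb1 ha₁
  have hab2' : a₂ ≠ b₁ := by rintro rfl; exact hb1 ha₂
  obtain ⟨s, t, ex⟩ := sa_comb hab1' h11 h12 h13
  obtain ⟨s', t', ex'⟩ := sa_comb hab2 h21 h22 h23
  obtain ⟨u, v, ez⟩ := sa_comb hab1 h31 h32 h33
  obtain ⟨u', v', ez'⟩ := sa_comb hab2' h41 h42 h43
  obtain ⟨p, q, eo⟩ := sa_comb ha ha₁ ha₂ ho₁
  obtain ⟨p', q', eo'⟩ := sa_comb hb hb₁ hb₂ ho₂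
  -- a multiple of a point is the same point
  have key : ∀ (y y' : PGPoint F) (c : F), y ≠ y' → y.rep ≠ c • y'.rep := by
    intro y y' c hy e
    have := sa_pair hy 1 (-c) (by rw [e, neg_smul, one_smul, add_neg_cancel])
    exact one_ne_zero this.1
  have hs : s ≠ 0 := by
    rintro rfl
    exact key x b₁ t hxb (by rw [ex]; simp)
  have ht' : t' ≠ 0 := by
    rintro rfl
    exact key x a₂ s' hxa (by rw [ex']; simp)
  have hv : v ≠ 0 := by
    rintro rfl
    exact key z a₁ u hza (by rw [ez]; simp)
  have hq' : q' ≠ 0 := by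
    rintro rfl
    exact key o b₁ p' hob (by rw [eo']; simp)
  rw [sa_mem_iff] at hb1 ha₁ ha₂
  have li : ∀ c d e : F, c • a₁.rep + d • a₂.rep + e • b₁.rep = 0 → c = 0 ∧ d = 0 ∧ e = 0 := by
    intro c d e h
    have he : e = 0 := by
      by_contra he
      apply hb1
      have : b₁.rep = e⁻¹ • (-(c • a₁.rep + d • a₂.rep)) := by
        have : -(c • a₁.rep + d • a₂.rep) = e • b₁.rep := by
          rw [neg_eq_iff_add_eq_zero]; exact h
        rw [this, smul_smul, inv_mul_cancel₀ he, one_smul]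
      rw [this]
      exact l₁.1.smul_mem _ (l₁.1.neg_mem (l₁.1.add_mem (l₁.1.smul_mem _ ha₁)
        (l₁.1.smul_mem _ ha₂)))
    subst he
    have := sa_pair ha c d (by simpa using h)
    exact ⟨this.1, this.2, rfl⟩
  rw [sa_mem_iff] at hx hz ho ⊢
  -- combine the three diagonal points
  have hmem := w.1.sub_mem (w.1.add_mem (w.1.smul_mem (v * q') hx) (w.1.smul_mem (v * t') ho))
    (w.1.smul_mem (t' * q') hz)
  have e4 := sa_fano_vec li ex ex' ez ez' eo eo'
  rw [e4] at hmem
  exact (w.1.smul_mem_iff (mul_ne_zero h2 (mul_ne_zero (mul_ne_zero hv hq') hs))).1 hmem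

/-- The two points of a 5-secant that are neither in `S` nor equal to `o`. -/
theorem sa_two {S : Set (PGPoint (ZMod 7))} {l : PGLine (ZMod 7)} {o : PGPoint (ZMod 7)}
    (h : (S ∩ {x | PGMem x l}).ncard = 5) (ho : PGMem o l) (hoS : o ∉ S) :
    ∃ a b, a ≠ b ∧ {x | PGMem x l ∧ x ∉ S ∧ x ≠ o} = {a, b} := by
  rw [← Set.ncard_eq_two]
  have hc := sa_card l
  have hfin : {x | PGMem x l}.Finite := Set.finite_of_ncard_ne_zero (by omega)
  have e : {x | PGMem x l ∧ x ∉ S ∧ x ≠ o} = {x | PGMem x l} \ insert o (S ∩ {x | PGMem x l}) := by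
    ext x
    simp only [Set.mem_ofPred_eq, Set.mem_sdiff, Set.mem_insert_iff, Set.mem_inter_iff]
    tauto
  have hsub : insert o (S ∩ {x | PGMem x l}) ⊆ {x | PGMem x l} := by
    rintro x (rfl | hx)
    · exact ho
    · exact hx.2
  rw [e, Set.ncard_sdiff hsub (hfin.subset hsub), Set.ncard_insert_of_notMem (fun h => hoS h.1)
    (hfin.subset Set.inter_subset_right), hc, h]

theorem sa_side {S : Set (PGPoint (ZMod 7))} (hS : IsTwoSemiarc S) {l₁ l₂ : PGLine (ZMod 7)}
    (hne : l₁ ≠ l₂) (h₁ : (S ∩ {x | PGMem x l₁}).ncard = 5) {o : PGPoint (ZMod 7)}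
    (ho₁ : PGMem o l₁) (ho₂ : PGMem o l₂) (hoS : o ∉ S) {b₁ b₂ : PGPoint (ZMod 7)}
    (hB : {x | PGMem x l₂ ∧ x ∉ S ∧ x ≠ o} = {b₁, b₂})
    {b : PGPoint (ZMod 7)} (hb : b ∈ ({b₁, b₂} : Set (PGPoint (ZMod 7))))
    {x : PGPoint (ZMod 7)} (hx : x ∈ S) (hx₁ : ¬ PGMem x l₁) (hx₂ : ¬ PGMem x l₂) :
    ∃ m r, PGMem x m ∧ PGMem b m ∧ PGMem r m ∧ PGMem r l₁ ∧ r ∉ S ∧ r ≠ o := by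
  have hb' := hb
  rw [← hB] at hb'
  obtain ⟨hbl, hbS, hbo⟩ := hb'
  have hxb : x ≠ b := by rintro rfl; exact hbS hx
  obtain ⟨m, hxm, hbm⟩ := sa_join hxb
  obtain ⟨r, hrm, hrl⟩ := sa_meet m l₁
  have hro : r ≠ o := by
    rintro rfl
    have := sa_unique hbo hbm hrm hbl ho₂
    exact hx₂ (this ▸ hxm)
  refine ⟨m, r, hxm, hbm, hrm, hrl, ?_, hro⟩
  intro hrS
  -- `r ∈ S ∩ l₁`, so its tangents are exactly the lines to `b₁`, `b₂`
  have hrl₂ : ¬ PGMem r l₂ := fun h => hne (sa_unique hro hrl ho₁ h ho₂)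
  have hrb : ∀ c ∈ ({b₁, b₂} : Set (PGPoint (ZMod 7))), r ≠ c := by
    intro c hc e
    rw [← hB] at hc
    exact hrl₂ (e ▸ hc.1)
  obtain ⟨t₁, hr1, hb1⟩ := sa_join (hrb b₁ (by simp))
  obtain ⟨t₂, hr2, hb2⟩ := sa_join (hrb b₂ (by simp))
  have hsub : {t : PGLine (ZMod 7) | PGTangent S t r} ⊆ {t₁, t₂} := by
    intro t ht
    have ht : S ∩ {x | PGMem x t} = {r} := ht
    have hrt : PGMem r t := by
      have : r ∈ S ∩ {x | PGMem x t} := by rw [ht]; rfl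
      exact this.2
    have htl : t ≠ l₁ := by
      rintro rfl
      rw [ht, Set.ncard_singleton] at h₁
      omega
    obtain ⟨q, hqt, hql⟩ := sa_meet t l₂
    have hqr : q ≠ r := by rintro rfl; exact hrl₂ hql
    have hqS : q ∉ S := by
      intro hq
      have : q ∈ S ∩ {x | PGMem x t} := ⟨hq, hqt⟩
      rw [ht] at this
      exact hqr this
    have hqo : q ≠ o := by
      rintro rfl
      exact htl (sa_unique hro hrt hqt hrl ho₁)
    have hqB : q ∈ ({b₁, b₂} : Set (PGPoint (ZMod 7))) := by rw [← hB]; exact ⟨hql, hqS, hqo⟩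
    rcases hqB with rfl | rfl
    · left; exact sa_unique hqr hqt hrt hb1 hr1
    · right; exact sa_unique hqr hqt hrt hb2 hr2
  have hle : ({t₁, t₂} : Set (PGLine (ZMod 7))).ncard ≤
      {t : PGLine (ZMod 7) | PGTangent S t r}.ncard := by
    rw [hS.2 r hrS]
    exact (Set.ncard_insert_le _ _).trans (by rw [Set.ncard_singleton])
  have heq := Set.eq_of_subset_of_ncard_le hsub hle (by simp)
  have hmt : m ∈ ({t₁, t₂} : Set (PGLine (ZMod 7))) := by
    rcases hb with rfl | rfl
    · left; exact sa_unique (hrb _ (by simp)) hrm hbm hr1 hb1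
    · right; exact sa_unique (hrb _ (by simp)) hrm hbm hr2 hb2
  rw [← heq] at hmt
  have hmt : S ∩ {x | PGMem x m} = {r} := hmt
  have : x ∈ S ∩ {x | PGMem x m} := ⟨hx, hxm⟩
  rw [hmt] at this
  exact hx₁ (by rw [Set.mem_singleton_iff.1 this]; exact hrl)

/-- Every extra point of `S` is one of the two diagonal points. -/
theorem sa_diag {S : Set (PGPoint (ZMod 7))} (hS : IsTwoSemiarc S) {l₁ l₂ : PGLine (ZMod 7)}
    (hne : l₁ ≠ l₂) (h₁ : (S ∩ {x | PGMem x l₁}).ncard = 5) {o : PGPoint (ZMod 7)}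
    (ho₁ : PGMem o l₁) (ho₂ : PGMem o l₂) (hoS : o ∉ S) {a₁ a₂ b₁ b₂ : PGPoint (ZMod 7)}
    (hbb : b₁ ≠ b₂)
    (hA : {x | PGMem x l₁ ∧ x ∉ S ∧ x ≠ o} = {a₁, a₂})
    (hB : {x | PGMem x l₂ ∧ x ∉ S ∧ x ≠ o} = {b₁, b₂})
    {x : PGPoint (ZMod 7)} (hx : x ∈ S) (hx₁ : ¬ PGMem x l₁) (hx₂ : ¬ PGMem x l₂) :
    (∃ m₁ m₂, PGMem x m₁ ∧ PGMem x m₂ ∧ PGMem a₁ m₁ ∧ PGMem b₁ m₁ ∧ PGMem a₂ m₂ ∧ PGMem b₂ m₂) ∨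
    (∃ m₁ m₂, PGMem x m₁ ∧ PGMem x m₂ ∧ PGMem a₁ m₁ ∧ PGMem b₂ m₁ ∧ PGMem a₂ m₂ ∧ PGMem b₁ m₂) := by
  obtain ⟨m, r, hxm, hbm, hrm, hrl, hrS, hro⟩ :=
    sa_side hS hne h₁ ho₁ ho₂ hoS hB (b := b₁) (by simp) hx hx₁ hx₂
  obtain ⟨n, s, hxn, hbn, hsn, hsl, hsS, hso⟩ :=
    sa_side hS hne h₁ ho₁ ho₂ hoS hB (b := b₂) (by simp) hx hx₁ hx₂
  have hb1 : b₁ ∈ {x | PGMem x l₂ ∧ x ∉ S ∧ x ≠ o} := by rw [hB]; simp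
  have hrs : r ≠ s := by
    rintro rfl
    have hxr : x ≠ r := by rintro rfl; exact hrS hx
    have hmn := sa_unique hxr hxm hrm hxn hsn
    subst hmn
    have := sa_unique hbb hbm hbn hb1.1
      (by have : b₂ ∈ {x | PGMem x l₂ ∧ x ∉ S ∧ x ≠ o} := by { rw [hB]; simp }
          exact this.1)
    exact hx₂ (this ▸ hxm)
  have hr : r ∈ ({a₁, a₂} : Set (PGPoint (ZMod 7))) := by rw [← hA]; exact ⟨hrl, hrS, hro⟩
  have hs : s ∈ ({a₁, a₂} : Set (PGPoint (ZMod 7))) := by rw [← hA]; exact ⟨hsl, hsS, hso⟩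
  rcases hr with rfl | rfl <;> rcases hs with rfl | rfl
  · exact absurd rfl hrs
  · left; exact ⟨m, n, hxm, hxn, hrm, hbm, hsn, hbn⟩
  · right; exact ⟨n, m, hxn, hxm, hsn, hbn, hrm, hbm⟩
  · exact absurd rfl hrs

/-- There is no extra point (first diagonal type). -/
theorem sa_false {S : Set (PGPoint (ZMod 7))} (hS : IsTwoSemiarc S) {l₁ l₂ : PGLine (ZMod 7)}
    (hne : l₁ ≠ l₂) (h₁ : (S ∩ {x | PGMem x l₁}).ncard = 5) {o : PGPoint (ZMod 7)}
    (ho₁ : PGMem o l₁) (ho₂ : PGMem o l₂) (hoS : o ∉ S) {a₁ a₂ b₁ b₂ : PGPoint (ZMod 7)}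
    (haa : a₁ ≠ a₂) (hbb : b₁ ≠ b₂)
    (hA : {x | PGMem x l₁ ∧ x ∉ S ∧ x ≠ o} = {a₁, a₂})
    (hB : {x | PGMem x l₂ ∧ x ∉ S ∧ x ≠ o} = {b₁, b₂})
    {x : PGPoint (ZMod 7)} (hx : x ∈ S) (hx₁ : ¬ PGMem x l₁) (hx₂ : ¬ PGMem x l₂)
    {m₁ m₂ : PGLine (ZMod 7)} (hxm₁ : PGMem x m₁) (hxm₂ : PGMem x m₂)
    (ha₁m : PGMem a₁ m₁) (hb₁m : PGMem b₁ m₁) (ha₂m : PGMem a₂ m₂) (hb₂m : PGMem b₂ m₂) :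
    False := by
  obtain ⟨ha₁, ha₁S, ha₁o⟩ : PGMem a₁ l₁ ∧ a₁ ∉ S ∧ a₁ ≠ o := by
    change a₁ ∈ {x | PGMem x l₁ ∧ x ∉ S ∧ x ≠ o}; rw [hA]; simp
  obtain ⟨ha₂, ha₂S, ha₂o⟩ : PGMem a₂ l₁ ∧ a₂ ∉ S ∧ a₂ ≠ o := by
    change a₂ ∈ {x | PGMem x l₁ ∧ x ∉ S ∧ x ≠ o}; rw [hA]; simp
  obtain ⟨hb₁, hb₁S, hb₁o⟩ : PGMem b₁ l₂ ∧ b₁ ∉ S ∧ b₁ ≠ o := by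
    change b₁ ∈ {x | PGMem x l₂ ∧ x ∉ S ∧ x ≠ o}; rw [hB]; simp
  obtain ⟨hb₂, hb₂S, hb₂o⟩ : PGMem b₂ l₂ ∧ b₂ ∉ S ∧ b₂ ≠ o := by
    change b₂ ∈ {x | PGMem x l₂ ∧ x ∉ S ∧ x ≠ o}; rw [hB]; simp
  have nl₂ : ∀ {y}, PGMem y l₁ → y ≠ o → ¬ PGMem y l₂ :=
    fun h h' h'' => hne (sa_unique h' h ho₁ h'' ho₂)
  have nl₁ : ∀ {y}, PGMem y l₂ → y ≠ o → ¬ PGMem y l₁ :=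
    fun h h' h'' => hne (sa_unique h' h'' ho₁ h ho₂)
  have hxo : x ≠ o := by rintro rfl; exact hoS hx
  obtain ⟨w, hxw, how⟩ := sa_join hxo
  -- points of `S` on a line through `x` and a non-`S` point of each of `l₁`, `l₂`
  have gen : ∀ {m p q z}, PGMem x m → PGMem p m → PGMem q m → PGMem p l₁ → p ∉ S →
      PGMem q l₂ → q ∉ S → z ∈ S → PGMem z m → ¬ PGMem z l₁ ∧ ¬ PGMem z l₂ := by
    intro m p q z hxm hpm hqm hp hpS hq hqS hz hzm
    constructor
    · intro h
      have hzp : z ≠ p := by rintro rfl; exact hpS hz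
      exact hx₁ (sa_unique hzp hzm hpm h hp ▸ hxm)
    · intro h
      have hzq : z ≠ q := by rintro rfl; exact hqS hz
      exact hx₂ (sa_unique hzq hzm hqm h hq ▸ hxm)
  have hm12 : m₁ ≠ m₂ := by
    rintro rfl
    exact hx₁ (sa_unique haa ha₁m ha₂m ha₁ ha₂ ▸ hxm₁)
  have hwm₁ : w ≠ m₁ := by
    rintro rfl
    exact hx₁ (sa_unique ha₁o ha₁m how ha₁ ho₁ ▸ hxw)
  have hwm₂ : w ≠ m₂ := by
    rintro rfl
    exact hx₁ (sa_unique ha₂o ha₂m how ha₂ ho₁ ▸ hxw)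
  have hxa₁ : x ≠ a₁ := by rintro rfl; exact hx₁ ha₁
  have hxa₂ : x ≠ a₂ := by rintro rfl; exact hx₁ ha₂
  have hxb₁ : x ≠ b₁ := by rintro rfl; exact hx₂ hb₁
  have hab₁₂ : a₁ ≠ b₂ := by rintro rfl; exact nl₁ hb₂ hb₂o ha₁
  have hab₂₂ : a₂ ≠ b₂ := by rintro rfl; exact nl₁ hb₂ hb₂o ha₂
  have fin : ∀ {m z}, PGMem x m → (m = w ∨ m = m₁ ∨ m = m₂) → z ∈ S → PGMem z m → z = x := by
    intro m z hxm hm hz hzm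
    have hzl : ¬ PGMem z l₁ ∧ ¬ PGMem z l₂ := by
      rcases hm with rfl | rfl | rfl
      · exact gen hxm how how ho₁ hoS ho₂ hoS hz hzm
      · exact gen hxm ha₁m hb₁m ha₁ ha₁S hb₁ hb₁S hz hzm
      · exact gen hxm ha₂m hb₂m ha₂ ha₂S hb₂ hb₂S hz hzm
    have hza₁ : z ≠ a₁ := by rintro rfl; exact ha₁S hz
    have hza₂ : z ≠ a₂ := by rintro rfl; exact ha₂S hz
    rcases sa_diag hS hne h₁ ho₁ ho₂ hoS hbb hA hB hz hzl.1 hzl.2 with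
      ⟨n₁, n₂, k₁, k₂, k₃, k₄, k₅, k₆⟩ | ⟨n₁, n₂, k₁, k₂, k₃, k₄, k₅, k₆⟩
    · have hab : a₁ ≠ b₁ := by rintro rfl; exact nl₁ hb₁ hb₁o ha₁
      have e1 := sa_unique hab k₃ k₄ ha₁m hb₁m
      have e2 := sa_unique hab₂₂ k₅ k₆ ha₂m hb₂m
      subst e1 e2
      by_contra hzx
      exact hm12 (sa_unique hzx k₁ hxm₁ k₂ hxm₂)
    · exfalso
      rcases hm with rfl | rfl | rfl
      · have := sa_fano (by decide) haa hbb (nl₁ hb₁ hb₁o) ha₁ ha₂ ho₁ hb₁ hb₂ ho₂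
          hb₁o.symm ha₁m hb₁m hxm₁ ha₂m hb₂m hxm₂ hab₂₂ k₃ k₄ k₁ hab₁₂ k₅ k₆ k₂ hxa₂ hza₁ hxb₁
          hxm hzm how
        exact hwm₁ (sa_unique hxa₁ hxm this hxm₁ ha₁m)
      · have := sa_unique hza₁ hzm ha₁m k₁ k₃
        subst this
        exact nl₂ ha₁ ha₁o (sa_unique hbb hb₁m k₄ hb₁ hb₂ ▸ ha₁m)
      · have := sa_unique hza₂ hzm ha₂m k₂ k₅
        subst this
        exact nl₂ ha₂ ha₂o (sa_unique hbb k₆ hb₂m hb₁ hb₂ ▸ ha₂m)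
  have hsub : ({w, m₁, m₂} : Set (PGLine (ZMod 7))) ⊆ {t | PGTangent S t x} := by
    intro m hm
    have hxm : PGMem x m := by rcases hm with rfl | rfl | rfl <;> assumption
    change S ∩ {y | PGMem y m} = {x}
    ext z
    simp only [Set.mem_inter_iff, Set.mem_ofPred_eq, Set.mem_singleton_iff]
    constructor
    · rintro ⟨hz, hzm⟩
      exact fin hxm hm hz hzm
    · rintro rfl
      exact ⟨hx, hxm⟩
  have h2 := hS.2 x hx
  have hle := Set.ncard_le_ncard hsub (Set.finite_of_ncard_ne_zero (by omega))
  rw [h2, Set.ncard_insert_of_notMem (by simp [hwm₁, hwm₂]) (by simp), Set.ncard_pair hm12] at hle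
  omega

/-- If a 2-semiarc in `PG(2,7)` has two 5-secants whose common point is not in the
semiarc, then it is the union of these two 5-secants and has 10 points. -/
theorem two_semiarc_PG2_7_two_five_secants (S : Set (PGPoint (ZMod 7)))
    (hS : IsTwoSemiarc S) (ℓ₁ ℓ₂ : PGLine (ZMod 7)) (hne : ℓ₁ ≠ ℓ₂)
    (h₁ : (S ∩ {x | PGMem x ℓ₁}).ncard = 5) (h₂ : (S ∩ {x | PGMem x ℓ₂}).ncard = 5)
    (hmeet : ∀ x : PGPoint (ZMod 7), PGMem x ℓ₁ → PGMem x ℓ₂ → x ∉ S) :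
    S ⊆ {x | PGMem x ℓ₁} ∪ {x | PGMem x ℓ₂} ∧
      S = (S ∩ {x | PGMem x ℓ₁}) ∪ (S ∩ {x | PGMem x ℓ₂}) ∧ S.ncard = 10 := by

  obtain ⟨o, ho₁, ho₂⟩ := sa_meet ℓ₁ ℓ₂
  have hoS := hmeet o ho₁ ho₂
  obtain ⟨a₁, a₂, haa, hA⟩ := sa_two h₁ ho₁ hoS
  obtain ⟨b₁, b₂, hbb, hB⟩ := sa_two h₂ ho₂ hoS
  have hsub : S ⊆ {x | PGMem x ℓ₁} ∪ {x | PGMem x ℓ₂} := by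
    intro x hx
    by_contra hn
    have hx₁ : ¬ PGMem x ℓ₁ := fun h => hn (Or.inl h)
    have hx₂ : ¬ PGMem x ℓ₂ := fun h => hn (Or.inr h)
    rcases sa_diag hS hne h₁ ho₁ ho₂ hoS hbb hA hB hx hx₁ hx₂ with
      ⟨n₁, n₂, k₁, k₂, k₃, k₄, k₅, k₆⟩ | ⟨n₁, n₂, k₁, k₂, k₃, k₄, k₅, k₆⟩
    · exact sa_false hS hne h₁ ho₁ ho₂ hoS haa hbb hA hB hx hx₁ hx₂ k₁ k₂ k₃ k₄ k₅ k₆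
    · exact sa_false hS hne h₁ ho₁ ho₂ hoS haa hbb.symm hA (by rw [hB, Set.pair_comm])
        hx hx₁ hx₂ k₁ k₂ k₃ k₄ k₅ k₆
  have heq : S = (S ∩ {x | PGMem x ℓ₁}) ∪ (S ∩ {x | PGMem x ℓ₂}) := by
    rw [← Set.inter_union_distrib_left]
    exact (Set.inter_eq_left.2 hsub).symm
  refine ⟨hsub, heq, ?_⟩
  rw [heq, Set.ncard_union_eq _ (Set.finite_of_ncard_ne_zero (by omega))
    (Set.finite_of_ncard_ne_zero (by omega)), h₁, h₂]
  rw [Set.disjoint_left]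
  rintro x ⟨hx, hx1⟩ ⟨_, hx2⟩
  exact hmeet x hx1 hx2 hx
end
end

section
/- Let S be a 2-semiarc in PG(2,7), and let ℓ₁ and ℓ₂ be two distinct 5-secants of S (lines each meeting S in exactly 5 points) such that the common point of ℓ₁ and ℓ₂ belongs to S. Then |S| ≥ 13. -/
noncomputable section

lemma submodule_eq_of_two {W₁ W₂ : Submodule (ZMod 7) (Fin 3 → ZMod 7)}
    (h₁ : Module.finrank (ZMod 7) W₁ = 2) (h₂ : Module.finrank (ZMod 7) W₂ = 2)
    {v x : Fin 3 → ZMod 7} (hv : v ≠ 0) (hx : x ∉ Submodule.span (ZMod 7) {v})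
    (hv1 : v ∈ W₁) (hv2 : v ∈ W₂) (hx1 : x ∈ W₁) (hx2 : x ∈ W₂) : W₁ = W₂ := by
  have hlt : Submodule.span (ZMod 7) {v} < W₁ ⊓ W₂ := by
    rw [SetLike.lt_iff_le_and_exists]
    refine ⟨?_, x, ⟨hx1, hx2⟩, hx⟩
    rw [Submodule.span_singleton_le_iff_mem]
    exact ⟨hv1, hv2⟩
  have h := Submodule.finrank_lt_finrank_of_lt hlt
  rw [finrank_span_singleton hv] at h
  have e1 : W₁ ⊓ W₂ = W₁ := Submodule.eq_of_le_of_finrank_le inf_le_left (by omega)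
  have e2 : W₁ ⊓ W₂ = W₂ := Submodule.eq_of_le_of_finrank_le inf_le_right (by omega)
  exact e1.symm.trans e2

lemma finrank_span_two {v x : Fin 3 → ZMod 7} (hv : v ≠ 0)
    (hx : x ∉ Submodule.span (ZMod 7) {v}) :
    Module.finrank (ZMod 7) (Submodule.span (ZMod 7) {v, x}) = 2 := by
  have hli : LinearIndependent (ZMod 7) ![v, x] := by
    rw [LinearIndependent.pair_iff' hv]
    intro c hc
    exact hx (Submodule.mem_span_singleton.2 ⟨c, hc⟩)
  have := finrank_span_eq_card hli
  rw [Matrix.range_cons, Matrix.range_cons, Matrix.range_empty, Set.union_empty,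
    Set.singleton_union] at this
  simpa using this

lemma exists_not_mem_span {W : Submodule (ZMod 7) (Fin 3 → ZMod 7)}
    (h : Module.finrank (ZMod 7) W = 2) {v : Fin 3 → ZMod 7} (hv : v ≠ 0) :
    ∃ x ∈ W, x ∉ Submodule.span (ZMod 7) {v} := by
  by_contra! hc
  have h1 : W ≤ Submodule.span (ZMod 7) {v} := hc
  have h2 := Submodule.finrank_mono h1
  rw [finrank_span_singleton hv] at h2
  omega

lemma pgMem_iff (p : PGPoint (ZMod 7)) (l : PGLine (ZMod 7)) : PGMem p l ↔ p.rep ∈ l.1 := by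
  unfold PGMem
  rw [Projectivization.submodule_eq, Submodule.span_singleton_le_iff_mem]

lemma line_eq_of_two {l m : PGLine (ZMod 7)} {p q : PGPoint (ZMod 7)} (hpq : q ≠ p)
    (hpl : PGMem p l) (hpm : PGMem p m) (hql : PGMem q l) (hqm : PGMem q m) : l = m := by
  rw [pgMem_iff] at *
  refine Subtype.ext (submodule_eq_of_two l.2 m.2 p.rep_nonzero ?_ hpl hpm hql hqm)
  intro h
  obtain ⟨c, hc⟩ := Submodule.mem_span_singleton.1 h
  apply hpq
  rw [← q.mk_rep, ← p.mk_rep, Projectivization.mk_eq_mk_iff']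
  exact ⟨c, hc⟩

/-- If a 2-semiarc in `PG(2,7)` has two 5-secants whose common point belongs to the
semiarc, then the semiarc has at least 13 points. -/
theorem two_semiarc_PG2_7_five_secants_meet_inside (S : Set (PGPoint (ZMod 7)))
    (hS : IsTwoSemiarc S) (ℓ₁ ℓ₂ : PGLine (ZMod 7)) (hne : ℓ₁ ≠ ℓ₂)
    (h₁ : (S ∩ {x | PGMem x ℓ₁}).ncard = 5) (h₂ : (S ∩ {x | PGMem x ℓ₂}).ncard = 5)
    (hmeet : ∃ x ∈ S, PGMem x ℓ₁ ∧ PGMem x ℓ₂) :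
    13 ≤ S.ncard := by
  classical
  obtain ⟨P, hPS, hP1, hP2⟩ := hmeet
  have hv := P.rep_nonzero
  have hv1 := (pgMem_iff _ _).1 hP1
  have hv2 := (pgMem_iff _ _).1 hP2
  obtain ⟨a, ha, hav⟩ := exists_not_mem_span ℓ₁.2 hv
  obtain ⟨b, hb, hbv⟩ := exists_not_mem_span ℓ₂.2 hv
  have hb1 : b ∉ ℓ₁.1 := fun h =>
    hne (Subtype.ext (submodule_eq_of_two ℓ₁.2 ℓ₂.2 hv hbv hv1 hv2 h hb))
  have ha2 : a ∉ ℓ₂.1 := fun h =>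
    hne (Subtype.ext (submodule_eq_of_two ℓ₁.2 ℓ₂.2 hv hav hv1 hv2 ha h))
  have hx1 : ∀ u : (ZMod 7)ˣ, a + (u : ZMod 7) • b ∉ ℓ₁.1 := by
    intro u h
    have h' := (Submodule.add_mem_iff_right _ ha).1 h
    exact hb1 ((Submodule.smul_mem_iff _ u.ne_zero).1 h')
  have hx2 : ∀ u : (ZMod 7)ˣ, a + (u : ZMod 7) • b ∉ ℓ₂.1 := by
    intro u h
    exact ha2 ((Submodule.add_mem_iff_left _ (Submodule.smul_mem _ _ hb)).1 h)
  have hxv : ∀ u : (ZMod 7)ˣ,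
      a + (u : ZMod 7) • b ∉ Submodule.span (ZMod 7) {P.rep} := by
    intro u h
    exact hx1 u ((Submodule.span_singleton_le_iff_mem _ _).2 hv1 h)
  let L : (ZMod 7)ˣ → PGLine (ZMod 7) := fun u =>
    ⟨Submodule.span (ZMod 7) {P.rep, a + (u : ZMod 7) • b}, finrank_span_two hv (hxv u)⟩
  have hLv : ∀ u, P.rep ∈ (L u).1 := fun u => Submodule.subset_span (by simp)
  have hLx : ∀ u, a + (u : ZMod 7) • b ∈ (L u).1 := fun u => Submodule.subset_span (by simp)
  have hLP : ∀ u, PGMem P (L u) := fun u => (pgMem_iff _ _).2 (hLv u)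
  have hL1 : ∀ u, L u ≠ ℓ₁ := fun u h => hx1 u (h ▸ hLx u)
  have hL2 : ∀ u, L u ≠ ℓ₂ := fun u h => hx2 u (h ▸ hLx u)
  have hinj : Function.Injective L := by
    intro u w h
    by_contra huw
    have hw : a + (w : ZMod 7) • b ∈ (L u).1 := h ▸ hLx w
    have hd := Submodule.sub_mem _ (hLx u) hw
    have hd' : ((u : ZMod 7) - w) • b ∈ (L u).1 := by
      rw [sub_smul]
      simpa using hd
    have hne0 : (u : ZMod 7) - w ≠ 0 := fun h0 => huw (Units.ext (sub_eq_zero.1 h0))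
    have hbL := (Submodule.smul_mem_iff _ hne0).1 hd'
    exact hL2 u (Subtype.ext (submodule_eq_of_two (L u).2 ℓ₂.2 hv hbv (hLv u) hv2 hbL hb))
  have hA : (Set.range L).ncard = 6 := by
    rw [← Set.image_univ, Set.ncard_image_of_injective _ hinj, Set.ncard_univ,
      Nat.card_eq_fintype_card, ZMod.card_units]
  set T := {ℓ : PGLine (ZMod 7) | PGTangent S ℓ P} with hT
  have hT2 : T.ncard = 2 := hS.2 P hPS
  have hTf : T.Finite := Set.finite_of_ncard_ne_zero (by omega)
  have hB : 4 ≤ (Set.range L \ T).ncard := by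
    have := Set.le_ncard_sdiff T (Set.range L) hTf
    omega
  have hex : ∀ l ∈ Set.range L \ T, ∃ x ∈ S, x ≠ P ∧ PGMem x l := by
    rintro l ⟨⟨u, rfl⟩, hl⟩
    by_contra! hc
    apply hl
    change S ∩ {x | PGMem x (L u)} = {P}
    ext x
    constructor
    · rintro ⟨hxS, hxl⟩
      by_contra hxP
      exact hc x hxS hxP hxl
    · rintro rfl
      exact ⟨hPS, hLP u⟩
  choose! f hfS hfP hfl using hex
  have hSf : S.Finite := Set.toFinite S
  have hC : 4 ≤ (S \ (S ∩ {x | PGMem x ℓ₁} ∪ S ∩ {x | PGMem x ℓ₂})).ncard := by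
    refine hB.trans (Set.ncard_le_ncard_of_injOn f ?_ ?_ (hSf.subset Set.sdiff_subset))
    · intro l hl
      have h1 := hfS l hl
      have h2 := hfP l hl
      have h3 := hfl l hl
      obtain ⟨⟨u, rfl⟩, -⟩ := hl
      refine ⟨h1, ?_⟩
      rintro (⟨-, h⟩ | ⟨-, h⟩)
      · exact hL1 u (line_eq_of_two h2 (hLP u) hP1 h3 h)
      · exact hL2 u (line_eq_of_two h2 (hLP u) hP2 h3 h)
    · intro l hl m hm h
      have h2 := hfP l hl
      have h3 := hfl l hl
      have h4 := hfl m hm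
      rw [← h] at h4
      obtain ⟨⟨u, rfl⟩, -⟩ := hl
      obtain ⟨⟨w, rfl⟩, -⟩ := hm
      exact line_eq_of_two h2 (hLP u) (hLP w) h3 h4
  have hI : (S ∩ {x | PGMem x ℓ₁}) ∩ (S ∩ {x | PGMem x ℓ₂}) = {P} := by
    ext x
    constructor
    · rintro ⟨⟨-, h⟩, -, h'⟩
      by_contra hxP
      exact hne (line_eq_of_two hxP hP1 hP2 h h')
    · rintro rfl
      exact ⟨⟨hPS, hP1⟩, hPS, hP2⟩
  have hU := Set.ncard_union_add_ncard_inter (S ∩ {x | PGMem x ℓ₁}) (S ∩ {x | PGMem x ℓ₂})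
    (Set.toFinite _) (Set.toFinite _)
  rw [hI, Set.ncard_singleton, h₁, h₂] at hU
  have hsub : S ∩ {x | PGMem x ℓ₁} ∪ S ∩ {x | PGMem x ℓ₂} ⊆ S :=
    Set.union_subset Set.inter_subset_left Set.inter_subset_left
  have := Set.ncard_sdiff_add_ncard_of_subset hsub hSf
  omega
end
end

section
/- There is no 2-semiarc of size 10 and no 2-semiarc of size 11 in PG(2,9), the Desarguesian projective plane over the field with 9 elements. -/
noncomputable section

open Classical in
/-- Local counting at a point. -/
theorem semiarc_local {P L : Type*} [Fintype P] [Fintype L] (M : P → L → Prop)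
    (h1 : ∀ p x, p ≠ x → (Finset.univ.filter fun l => M p l ∧ M x l).card = 1)
    (h10 : ∀ p, (Finset.univ.filter fun l => M p l).card = 10)
    (S : Finset P) (n : L → ℕ) (hn : ∀ l, n l = (S.filter fun x => M x l).card)
    (p : P) (hp : p ∈ S)
    (ht : (Finset.univ.filter fun l => M p l ∧ n l = 1).card = 2) :
    ∑ l ∈ Finset.univ.filter (fun l => M p l ∧ n l ≠ 1), (n l - 2) + 9 = S.card := by
  have hpos : ∀ l, M p l → 1 ≤ n l := by
    intro l hl
    rw [hn]
    exact Finset.card_pos.mpr ⟨p, by simp [hp, hl]⟩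
  have hT : (Finset.univ.filter fun l => M p l ∧ n l ≠ 1).card = 8 := by
    have h := Finset.card_filter_add_card_filter_not
      (s := Finset.univ.filter fun l => M p l) (fun l => n l = 1)
    rw [Finset.filter_filter, Finset.filter_filter, h10, ht] at h
    have : (Finset.univ.filter fun l => M p l ∧ n l ≠ 1).card
      = (Finset.univ.filter fun l => M p l ∧ ¬ n l = 1).card := rfl
    omega
  have hdc := Finset.sum_card_bipartiteAbove_eq_sum_card_bipartiteBelow
    (s := S.erase p) (t := Finset.univ.filter fun l => M p l) M
  have hL : ∑ x ∈ S.erase p,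
      ((Finset.univ.filter fun l => M p l).bipartiteAbove M x).card = (S.erase p).card := by
    rw [Finset.card_eq_sum_ones]
    refine Finset.sum_congr rfl fun x hx => ?_
    rw [← h1 p x (Finset.ne_of_mem_erase hx).symm, Finset.bipartiteAbove, Finset.filter_filter]
  have hR : ∀ l ∈ Finset.univ.filter (fun l => M p l),
      ((S.erase p).bipartiteBelow M l).card = n l - 1 := by
    intro l hl
    rw [Finset.bipartiteBelow, Finset.filter_erase, Finset.card_erase_of_mem, hn]
    simp only [Finset.mem_filter, Finset.mem_univ, true_and] at hl
    simp [hp, hl]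
  rw [hL, Finset.sum_congr rfl hR, Finset.card_erase_of_mem hp] at hdc
  have hsplit := Finset.sum_filter_add_sum_filter_not
    (Finset.univ.filter fun l => M p l) (fun l => n l = 1) (fun l => n l - 1)
  rw [Finset.filter_filter, Finset.filter_filter, ← hdc] at hsplit
  have hz : ∑ l ∈ Finset.univ.filter (fun l => M p l ∧ n l = 1), (n l - 1) = 0 := by
    refine Finset.sum_eq_zero fun l hl => ?_
    simp only [Finset.mem_filter] at hl
    omega
  have hs : ∑ l ∈ Finset.univ.filter (fun l => M p l ∧ ¬ n l = 1), (n l - 1)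
      = ∑ l ∈ Finset.univ.filter (fun l => M p l ∧ n l ≠ 1), (n l - 2) + 8 := by
    rw [← hT, Finset.card_eq_sum_ones, ← Finset.sum_add_distrib]
    refine Finset.sum_congr rfl fun l hl => ?_
    simp only [Finset.mem_filter, Finset.mem_univ, true_and] at hl
    have := hpos l hl.1
    omega
  have : 1 ≤ S.card := Finset.card_pos.mpr ⟨p, hp⟩
  omega

open Classical in
/-- Double counting of incident pairs on `j`-secants. -/
theorem semiarc_global {P L : Type*} [Fintype P] [Fintype L] (M : P → L → Prop)
    (S : Finset P) (n : L → ℕ) (hn : ∀ l, n l = (S.filter fun x => M x l).card) (j : ℕ) :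
    ∑ p ∈ S, (Finset.univ.filter fun l => M p l ∧ n l = j).card
      = (Finset.univ.filter fun l => n l = j).card * j := by
  have hdc := Finset.sum_card_bipartiteAbove_eq_sum_card_bipartiteBelow
    (s := S) (t := Finset.univ.filter fun l => n l = j) M
  rw [Finset.sum_congr rfl (g := fun _ => j) (s₁ := Finset.univ.filter fun l => n l = j)
    (fun l hl => ?_)] at hdc
  · rw [Finset.sum_const, smul_eq_mul] at hdc
    rw [← hdc]
    refine Finset.sum_congr rfl fun p _ => ?_
    rw [Finset.bipartiteAbove, Finset.filter_filter]
    congr 1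
    ext l
    simp [and_comm]
  · simp only [Finset.mem_filter, Finset.mem_univ, true_and] at hl
    rw [← hl, hn]
    rfl

open Classical in
theorem semiarc_abstract {P L : Type*} [Fintype P] [Fintype L] (M : P → L → Prop)
    (h1 : ∀ p x, p ≠ x → (Finset.univ.filter fun l => M p l ∧ M x l).card = 1)
    (h10 : ∀ p, (Finset.univ.filter fun l => M p l).card = 10)
    (S : Finset P) (n : L → ℕ) (hn : ∀ l, n l = (S.filter fun x => M x l).card)
    (ht : ∀ p ∈ S, (Finset.univ.filter fun l => M p l ∧ n l = 1).card = 2) :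
    S.card ≠ 10 ∧ S.card ≠ 11 := by
  have hloc := fun p hp => semiarc_local M h1 h10 S n hn p hp (ht p hp)
  have hg := semiarc_global M S n hn
  have hind : ∀ p j, j ≠ 1 → (Finset.univ.filter fun l => M p l ∧ n l = j).card
      = ∑ l ∈ Finset.univ.filter (fun l => M p l ∧ n l ≠ 1), if n l = j then 1 else 0 := by
    intro p j hj
    rw [← Finset.card_filter, Finset.filter_filter]
    congr 1
    ext l
    simp only [Finset.mem_filter, Finset.mem_univ, true_and]
    constructor
    · rintro ⟨a, b⟩
      exact ⟨⟨a, by omega⟩, b⟩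
    · rintro ⟨⟨a, _⟩, b⟩
      exact ⟨a, b⟩
  constructor
  · intro hk
    have h3 : ∀ p ∈ S, (Finset.univ.filter fun l => M p l ∧ n l = 3).card = 1 := by
      intro p hp
      have h := hloc p hp
      have hle := fun l hl => Finset.single_le_sum
        (s := Finset.univ.filter (fun l => M p l ∧ n l ≠ 1)) (f := fun l => n l - 2)
        (fun _ _ => Nat.zero_le _) (a := l) hl
      rw [hind p 3 (by norm_num)]
      have h2 : ∑ l ∈ Finset.univ.filter (fun l => M p l ∧ n l ≠ 1), (n l - 2) = 1 := by omega
      refine Eq.trans (Finset.sum_congr rfl fun l hl => ?_) h2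
      have := hle l hl
      split_ifs <;> omega
    have := hg 3
    rw [Finset.sum_congr rfl h3] at this
    simp only [Finset.sum_const, smul_eq_mul] at this
    omega
  · intro hk
    have h3 : ∀ p ∈ S, (Finset.univ.filter fun l => M p l ∧ n l = 3).card
        + (Finset.univ.filter fun l => M p l ∧ n l = 4).card * 2 = 2 := by
      intro p hp
      have h := hloc p hp
      have hle := fun l hl => Finset.single_le_sum
        (s := Finset.univ.filter (fun l => M p l ∧ n l ≠ 1)) (f := fun l => n l - 2)
        (fun _ _ => Nat.zero_le _) (a := l) hl
      rw [hind p 3 (by norm_num), hind p 4 (by norm_num), Finset.sum_mul,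
        ← Finset.sum_add_distrib]
      have h2 : ∑ l ∈ Finset.univ.filter (fun l => M p l ∧ n l ≠ 1), (n l - 2) = 2 := by omega
      refine Eq.trans (Finset.sum_congr rfl fun l hl => ?_) h2
      have := hle l hl
      split_ifs <;> omega
    have hsum := Finset.sum_congr rfl h3
    rw [Finset.sum_add_distrib, ← Finset.sum_mul, hg, hg, Finset.sum_const, hk, smul_eq_mul]
      at hsum
    have hN3 : (Finset.univ.filter fun l => n l = 3).card = 2 := by omega
    obtain ⟨a, b, hab, hEq⟩ := Finset.card_eq_two.mp hN3
    have ha : n a = 3 := by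
      have : a ∈ Finset.univ.filter fun l => n l = 3 := by rw [hEq]; simp
      simpa using this
    have hb : n b = 3 := by
      have : b ∈ Finset.univ.filter fun l => n l = 3 := by rw [hEq]; simp
      simpa using this
    have key : ∀ p ∈ S, M p a → M p b := by
      intro p hp hpa
      have hpos : 0 < (Finset.univ.filter fun l => M p l ∧ n l = 3).card :=
        Finset.card_pos.mpr ⟨a, by simp [hpa, ha]⟩
      have h2 := h3 p hp
      have hsub : (Finset.univ.filter fun l => M p l ∧ n l = 3)
          = Finset.univ.filter fun l => n l = 3 := by
        refine Finset.eq_of_subset_of_card_le (fun l hl => ?_) (by omega)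
        simp only [Finset.mem_filter, Finset.mem_univ, true_and] at hl ⊢
        exact hl.2
      have : b ∈ Finset.univ.filter fun l => M p l ∧ n l = 3 := by
        rw [hsub]
        simp [hb]
      simp only [Finset.mem_filter, Finset.mem_univ, true_and] at this
      exact this.1
    obtain ⟨p, hp, q, hq, hpq⟩ := Finset.one_lt_card.mp
      (show 1 < (S.filter fun x => M x a).card by rw [← hn, ha]; norm_num)
    simp only [Finset.mem_filter] at hp hq
    obtain ⟨c, hc⟩ := Finset.card_eq_one.mp (h1 p q hpq)
    have hac : a ∈ Finset.univ.filter fun l => M p l ∧ M q l := by simp [hp, hq]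
    have hbc : b ∈ Finset.univ.filter fun l => M p l ∧ M q l := by
      simp [key p hp.1 hp.2, key q hq.1 hq.2]
    rw [hc, Finset.mem_singleton] at hac hbc
    exact hab (hac.trans hbc.symm)

/-- A point and a vector off it span a unique line. -/
theorem pg_unique_line {F : Type*} [Field F] (p : PGPoint F) (v : Fin 3 → F)
    (hv : v ∉ p.submodule) : ∃! l : PGLine F, PGMem p l ∧ v ∈ l.1 := by
  have hv0 : v ≠ 0 := fun h => hv (h ▸ p.submodule.zero_mem)
  have hdis : p.submodule ⊓ Submodule.span F {v} = ⊥ := by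
    rw [← disjoint_iff, Submodule.disjoint_span_singleton' hv0]
    exact hv
  have hfr : Module.finrank F (p.submodule ⊔ Submodule.span F {v} : Submodule F (Fin 3 → F))
      = 2 := by
    have h := Submodule.finrank_sup_add_finrank_inf_eq p.submodule (Submodule.span F {v})
    rw [hdis, finrank_bot, p.finrank_submodule, finrank_span_singleton hv0] at h
    omega
  refine ⟨⟨_, hfr⟩, ⟨le_sup_left, ?_⟩, ?_⟩
  · exact (le_sup_right : _ ≤ p.submodule ⊔ Submodule.span F {v})
      (Submodule.mem_span_singleton_self v)
  · rintro ⟨W, hW⟩ ⟨h1, h2⟩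
    apply Subtype.ext
    symm
    refine Submodule.eq_of_le_of_finrank_eq (sup_le h1 ?_) (hfr.trans hW.symm)
    rwa [Submodule.span_singleton_le_iff_mem]

theorem pg_line_two {F : Type*} [Field F] (p x : PGPoint F) (h : p ≠ x) :
    ∃! l : PGLine F, PGMem p l ∧ PGMem x l := by
  have hx : x.submodule = Submodule.span F {x.rep} := x.submodule_eq
  have hv : x.rep ∉ p.submodule := by
    intro hm
    apply h
    apply Projectivization.submodule_injective
    symm
    refine Submodule.eq_of_le_of_finrank_eq ?_ (by simp [Projectivization.finrank_submodule])
    rwa [hx, Submodule.span_singleton_le_iff_mem]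
  have := pg_unique_line p _ hv
  simpa only [PGMem, hx, Submodule.span_singleton_le_iff_mem] using this

open Classical in
theorem pg_lines_through {F : Type*} [Field F] [Fintype F] [Fintype (PGLine F)]
    (hF : Fintype.card F = 9) (p : PGPoint F) :
    (Finset.univ.filter fun l : PGLine F => PGMem p l).card = 10 := by
  have hsub : ∀ W : Submodule F (Fin 3 → F),
      (Finset.univ.filter fun v => v ∈ W).card = 9 ^ Module.finrank F W := by
    intro W
    rw [← hF, ← Module.card_eq_pow_finrank (K := F) (V := W), Fintype.card_subtype]
  have hp9 := hsub p.submodule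
  rw [p.finrank_submodule] at hp9
  have htot : (Finset.univ.filter fun v => v ∉ p.submodule).card = 720 := by
    have h := Finset.card_filter_add_card_filter_not
      (s := (Finset.univ : Finset (Fin 3 → F))) (fun v => v ∈ p.submodule)
    rw [hp9, Finset.card_univ, Fintype.card_fun, hF, Fintype.card_fin] at h
    omega
  have hdc := Finset.sum_card_bipartiteAbove_eq_sum_card_bipartiteBelow
    (s := Finset.univ.filter fun v => v ∉ p.submodule)
    (t := Finset.univ.filter fun l : PGLine F => PGMem p l) (fun v l => v ∈ l.1)
  have hL : ∀ v ∈ Finset.univ.filter (fun v => v ∉ p.submodule),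
      ((Finset.univ.filter fun l : PGLine F => PGMem p l).bipartiteAbove
        (fun v l => v ∈ l.1) v).card = 1 := by
    intro v hv
    simp only [Finset.mem_filter, Finset.mem_univ, true_and] at hv
    obtain ⟨l, hl, hu⟩ := pg_unique_line p v hv
    rw [Finset.card_eq_one]
    refine ⟨l, ?_⟩
    ext m
    simp only [Finset.bipartiteAbove, Finset.mem_filter, Finset.mem_univ, true_and,
      Finset.mem_singleton]
    exact ⟨hu m, fun h => h ▸ hl⟩
  have hR : ∀ l ∈ Finset.univ.filter (fun l : PGLine F => PGMem p l),
      ((Finset.univ.filter fun v => v ∉ p.submodule).bipartiteBelow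
        (fun v (l : PGLine F) => v ∈ l.1) l).card = 72 := by
    intro l hl
    simp only [Finset.mem_filter, Finset.mem_univ, true_and] at hl
    have hl81 := hsub l.1
    rw [l.2] at hl81
    have h := Finset.card_filter_add_card_filter_not
      (s := Finset.univ.filter fun v => v ∈ l.1) (fun v => v ∈ p.submodule)
    rw [Finset.filter_filter, Finset.filter_filter, hl81] at h
    have e1 : (Finset.univ.filter fun v => v ∈ l.1 ∧ v ∈ p.submodule)
        = Finset.univ.filter fun v => v ∈ p.submodule := by
      ext v
      simp only [Finset.mem_filter, Finset.mem_univ, true_and]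
      exact ⟨fun h => h.2, fun h => ⟨hl h, h⟩⟩
    rw [e1, hp9] at h
    have e2 : (Finset.univ.filter fun v => v ∉ p.submodule).bipartiteBelow
        (fun v (l : PGLine F) => v ∈ l.1) l
        = Finset.univ.filter fun v => v ∈ l.1 ∧ v ∉ p.submodule := by
      ext v
      simp only [Finset.bipartiteBelow, Finset.mem_filter, Finset.mem_univ, true_and, and_comm]
    rw [e2]
    omega
  rw [Finset.sum_congr rfl hL, Finset.sum_congr rfl hR, Finset.sum_const, Finset.sum_const,
    htot, smul_eq_mul, smul_eq_mul] at hdc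
  omega

/-- There is no 2-semiarc of size 10 or 11 in `PG(2,9)`. -/
theorem two_semiarc_PG2_9_no_ten_eleven
    (S : Set (PGPoint (GaloisField 3 2))) (hS : IsTwoSemiarc S) :
    S.ncard ≠ 10 ∧ S.ncard ≠ 11 := by
  classical
  have : Fintype (GaloisField 3 2) := Fintype.ofFinite _
  have hF : Fintype.card (GaloisField 3 2) = 9 := by
    rw [← Nat.card_eq_fintype_card, GaloisField.card 3 2 (by norm_num)]
    norm_num
  have : Fintype (PGPoint (GaloisField 3 2)) := Fintype.ofFinite _
  have : Fintype (PGLine (GaloisField 3 2)) := Fintype.ofFinite _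
  have hmain := semiarc_abstract (P := PGPoint (GaloisField 3 2))
    (L := PGLine (GaloisField 3 2)) PGMem ?_ ?_ S.toFinset
    (fun l => (S.toFinset.filter fun x => PGMem x l).card) ?_ ?_
  · rwa [Set.ncard_eq_toFinset_card']
  · intro p x h
    obtain ⟨l, hl, hu⟩ := pg_line_two p x h
    rw [Finset.card_eq_one]
    refine ⟨l, ?_⟩
    ext m
    simp only [Finset.mem_filter, Finset.mem_univ, true_and, Finset.mem_singleton]
    exact ⟨hu m, fun h => h ▸ hl⟩
  · intro p
    convert pg_lines_through hF p
  · intro l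
    congr
  · intro p hp
    rw [Set.mem_toFinset] at hp
    refine Eq.trans ?_ (hS.2 p hp)
    rw [Set.ncard_eq_toFinset_card']
    congr 1
    ext l
    rw [Set.mem_toFinset, Finset.mem_filter]
    simp only [Finset.mem_univ, true_and]
    change _ ↔ S ∩ {x | PGMem x l} = {p}
    have hmem : ∀ x, x ∈ S.toFinset.filter (fun x => PGMem x l) ↔ x ∈ S ∩ {x | PGMem x l} := by
      intro x
      simp
    constructor
    · rintro ⟨h1, h2⟩
      obtain ⟨c, hc⟩ := Finset.card_eq_one.mp h2
      have hpc : p ∈ S.toFinset.filter (fun x => PGMem x l) := by simp [hp, h1]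
      rw [hc, Finset.mem_singleton] at hpc
      subst hpc
      ext x
      rw [← hmem, hc]
      simp
    · intro h
      have hpm : p ∈ S ∩ {x | PGMem x l} := by rw [h]; rfl
      refine ⟨hpm.2, Finset.card_eq_one.mpr ⟨p, ?_⟩⟩
      ext x
      rw [hmem, h]
      simp
end
end
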